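/- arXiv:2005.05797 — 2 statements merged into one kernel-verified Lean document; each statement's English description precedes it below -/
import Mathlib

section
/- Let E be a subset of ℝ^n, and suppose there exists a Borel set Ẽ ⊇ E, a point x and a nonempty open set U ⊆ G(1,n) of lines, such that for every line L through any point of Ẽ with direction in U, the intersection Ẽ ∩ L is at most countable. Then the Hausdorff dimension of E is at most n − 1. -/
open scoped ENNReal

namespace Slice

open MeasureTheory Set Filter Topology ProbabilityTheory


/-- index of the dyadic cube of level `k` containing `x`. -/
noncomputable def cidx {d : ℕ} (k : ℕ) (x : Fin d → ℝ) : Fin d → ℤ := fun i => ⌊2 ^ k * x i⌋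

abbrev W (d : ℕ) := ℕ × (Fin d → ℤ)

/-- half-open dyadic cubes -/
def Q {d : ℕ} (w : W d) : Set (Fin d → ℝ) := {x | cidx w.1 x = w.2}

lemma cidx_succ {d : ℕ} (k : ℕ) (x : Fin d → ℝ) (i : Fin d) :
    cidx k x i = cidx (k+1) x i / 2 := by
  unfold cidx
  have h : (2:ℝ) ^ k * x i = (2 ^ (k+1) * x i) / (2:ℕ) := by
    push_cast; rw [pow_succ]; ring
  rw [h, Int.floor_div_natCast]; rfl

lemma cidx_eq_succ {d : ℕ} {k : ℕ} {x y : Fin d → ℝ} (h : cidx (k+1) x = cidx (k+1) y) :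
    cidx k x = cidx k y := by
  ext i; rw [cidx_succ k x, cidx_succ k y, h]

lemma cidx_eq_le {d : ℕ} {j k : ℕ} (hjk : j ≤ k) {x y : Fin d → ℝ} (h : cidx k x = cidx k y) :
    cidx j x = cidx j y := by
  induction k, hjk using Nat.le_induction with
  | base => exact h
  | succ k hk ih => exact ih (cidx_eq_succ h)

lemma measurable_cidx {d : ℕ} (k : ℕ) : Measurable (cidx (d := d) k) := by
  unfold cidx
  refine measurable_pi_lambda _ fun i => ?_
  exact Int.measurable_floor.comp ((measurable_pi_apply i).const_mul _)

lemma measurableSet_Q {d : ℕ} (w : W d) : MeasurableSet (Q w) :=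
  measurable_cidx w.1 (measurableSet_singleton w.2)

lemma mem_Q_self {d : ℕ} (k : ℕ) (x : Fin d → ℝ) : x ∈ Q (k, cidx k x) := rfl

lemma dist_le_of_cidx_eq {d : ℕ} {k : ℕ} {x y : Fin d → ℝ} (h : cidx k x = cidx k y) :
    dist x y ≤ (2⁻¹ : ℝ) ^ k := by
  rw [dist_pi_le_iff (by positivity)]
  intro i
  have hi := congrFun h i
  have := (Int.abs_sub_lt_one_of_floor_eq_floor hi).le
  rw [← mul_sub, abs_mul, abs_of_pos (by positivity : (0:ℝ) < 2 ^ k)] at this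
  rw [Real.dist_eq, inv_pow, ← one_div, le_div_iff₀ (by positivity)]
  linarith

lemma ediam_Q {d : ℕ} (w : W d) : Metric.ediam (Q w) ≤ (2⁻¹ : ℝ≥0∞) ^ w.1 := by
  refine Metric.ediam_le fun x hx y hy => ?_
  have h := dist_le_of_cidx_eq (show cidx w.1 x = cidx w.1 y from hx.trans hy.symm)
  rw [edist_dist]
  refine (ENNReal.ofReal_le_ofReal h).trans (le_of_eq ?_)
  rw [ENNReal.ofReal_pow (by positivity), ENNReal.ofReal_inv_of_pos (by norm_num)]
  simp

noncomputable def cc {d : ℕ} (s : ℝ) (w : W d) : ℝ≥0∞ := ((2⁻¹ : ℝ≥0∞) ^ w.1) ^ s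

noncomputable def cost {d : ℕ} (s : ℝ) : Measure (W d) :=
  Measure.sum fun w => cc s w • Measure.dirac w

lemma cost_singleton {d : ℕ} (s : ℝ) (w : W d) : cost s {w} = cc s w := by
  classical
  unfold cost
  rw [Measure.sum_apply _ (measurableSet_singleton _), tsum_eq_single w]
  · simp
  · intro b hb
    simp [hb]

lemma meas_W {d : ℕ} (S : Set (W d)) : MeasurableSet S := S.to_countable.measurableSet

lemma cost_eq_tsum {d : ℕ} (s : ℝ) (S : Set (W d)) : cost s S = ∑' w : S, cc s w.1 := by
  conv_lhs => rw [← biUnion_of_singleton S]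
  rw [measure_biUnion S.to_countable]
  · simp only [cost_singleton]
  · intro a _ b _ hab
    simpa using hab
  · intro a _; exact measurableSet_singleton _

lemma cc_le_cost {d : ℕ} (s : ℝ) {S : Set (W d)} {w : W d} (h : w ∈ S) : cc s w ≤ cost s S := by
  rw [← cost_singleton]; exact measure_mono (by simpa using h)

def Cov {d : ℕ} (S : Set (W d)) : Set (Fin d → ℝ) := {x | ∃ w ∈ S, x ∈ Q w}

/-- dyadic Hausdorff content -/
noncomputable def M {d : ℕ} (s : ℝ) (A : Set (Fin d → ℝ)) : ℝ≥0∞ :=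
  ⨅ (S : Set (W d)) (_ : A ⊆ Cov S), cost s S

lemma M_le {d : ℕ} {s : ℝ} {A : Set (Fin d → ℝ)} {S : Set (W d)} (h : A ⊆ Cov S) :
    M s A ≤ cost s S := iInf₂_le S h

lemma exists_cov {d : ℕ} {s : ℝ} {A : Set (Fin d → ℝ)} {t : ℝ≥0∞} (h : M s A < t) :
    ∃ S : Set (W d), A ⊆ Cov S ∧ cost s S < t := by
  unfold M at h
  simp only [iInf_lt_iff] at h
  obtain ⟨S, hS, h⟩ := h
  exact ⟨S, hS, h⟩

lemma M_mono {d : ℕ} {s : ℝ} {A B : Set (Fin d → ℝ)} (h : A ⊆ B) : M s A ≤ M s B :=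
  le_iInf₂ fun _ hS => M_le (h.trans hS)

lemma M_Q_le {d : ℕ} {s : ℝ} (w : W d) : M s (Q w) ≤ cc s w := by
  rw [← cost_singleton]
  exact M_le fun x hx => ⟨w, rfl, hx⟩

lemma M_empty {d : ℕ} {s : ℝ} : M s (∅ : Set (Fin d → ℝ)) = 0 := by
  have : M s (∅ : Set (Fin d → ℝ)) ≤ cost s (∅ : Set (W d)) := M_le (by simp)
  simpa using this

lemma M_iUnion_le {d : ℕ} {s : ℝ} {ι : Type*} [Countable ι] (A : ι → Set (Fin d → ℝ)) :
    M s (⋃ i, A i) ≤ ∑' i, M s (A i) := by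
  refine ENNReal.le_of_forall_pos_le_add fun ε hε hfin => ?_
  obtain ⟨ε', hε', hsum⟩ := ENNReal.exists_pos_sum_of_countable (ε := ε)
    (by exact_mod_cast hε.ne') ι
  have hlt : ∀ i, M s (A i) < M s (A i) + ε' i := fun i =>
    ENNReal.lt_add_right (ENNReal.ne_top_of_tsum_ne_top hfin.ne i) (by exact_mod_cast (hε' i).ne')
  choose S hS hc using fun i => exists_cov (hlt i)
  calc M s (⋃ i, A i) ≤ cost s (⋃ i, S i) := by
        refine M_le (iUnion_subset fun i x hx => ?_)
        obtain ⟨w, hw, hxw⟩ := hS i hx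
        exact ⟨w, mem_iUnion.2 ⟨i, hw⟩, hxw⟩
    _ ≤ ∑' i, cost s (S i) := measure_iUnion_le _
    _ ≤ ∑' i, (M s (A i) + ε' i) := ENNReal.tsum_le_tsum fun i => (hc i).le
    _ = ∑' i, M s (A i) + ∑' i, (ε' i : ℝ≥0∞) := ENNReal.tsum_add
    _ ≤ _ := by gcongr

def Mx {d : ℕ} (S : Set (W d)) : Set (W d) :=
  {w | w ∈ S ∧ ∀ w' ∈ S, w'.1 < w.1 → ∀ y, y ∈ Q w → y ∉ Q w'}

lemma Mx_subset {d : ℕ} (S : Set (W d)) : Mx S ⊆ S := fun _ h => h.1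

lemma Cov_Mx {d : ℕ} (S : Set (W d)) : Cov S ⊆ Cov (Mx S) := by
  classical
  intro x hx
  have hex : ∃ k, ∃ w ∈ S, x ∈ Q w ∧ w.1 = k := by
    obtain ⟨w, h1, h2⟩ := hx; exact ⟨_, w, h1, h2, rfl⟩
  obtain ⟨w, hw, hxw, hk⟩ := Nat.find_spec hex
  refine ⟨w, ⟨hw, fun w' hw' hlt y hy hy' => ?_⟩, hxw⟩
  refine Nat.find_min hex (m := w'.1) (by rw [← hk]; exact hlt) ⟨w', hw', ?_, rfl⟩
  have : cidx w.1 x = cidx w.1 y := hxw.trans hy.symm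
  exact (cidx_eq_le hlt.le this).trans hy'

lemma Mx_anti {d : ℕ} {S T : Set (W d)} (h : T ⊆ S) {w : W d} (hw : w ∈ Mx S) (hT : w ∈ T) :
    w ∈ Mx T := ⟨hT, fun w' hw' => hw.2 w' (h hw')⟩

lemma strong_sub {d : ℕ} {s : ℝ} {A : Set (Fin d → ℝ)} {C D : Set (W d)}
    (hC : A ⊆ Cov C) (hD : A ⊆ Cov D) :
    cost s (Mx (C ∪ D)) + M s A ≤ cost s C + cost s D := by
  have h1 : A ⊆ Cov (((C ∪ D) \ Mx (C ∪ D)) ∪ (C ∩ D)) := by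
    intro x hx
    obtain ⟨w, hw, hxw⟩ := hC hx
    obtain ⟨v, hv, hxv⟩ := hD hx
    rcases lt_trichotomy w.1 v.1 with h | h | h
    · exact ⟨v, Or.inl ⟨Or.inr hv, fun hm => hm.2 w (Or.inl hw) h x hxv hxw⟩, hxv⟩
    · have : w = v := by
        refine Prod.ext h ?_
        have e1 : cidx w.1 x = w.2 := hxw
        have e2 : cidx v.1 x = v.2 := hxv
        rw [← e1, ← e2, h]
      subst this
      exact ⟨w, Or.inr ⟨hw, hv⟩, hxw⟩
    · exact ⟨w, Or.inl ⟨Or.inl hw, fun hm => hm.2 v (Or.inr hv) h x hxw hxv⟩, hxw⟩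
  calc cost s (Mx (C ∪ D)) + M s A
      ≤ cost s (Mx (C ∪ D)) + (cost s ((C ∪ D) \ Mx (C ∪ D)) + cost s (C ∩ D)) := by
        gcongr; exact (M_le h1).trans (measure_union_le _ _)
    _ = cost s (C ∪ D) + cost s (C ∩ D) := by
        rw [← add_assoc, ← measure_inter_add_sdiff (C ∪ D) (meas_W (Mx (C ∪ D))),
          inter_eq_self_of_subset_right (Mx_subset _)]
    _ = _ := measure_union_add_inter _ (meas_W D)

/-- increasing sets lemma -/
lemma M_iUnion_mono {d : ℕ} {s : ℝ} {A : ℕ → Set (Fin d → ℝ)} (hA : Monotone A) :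
    M s (⋃ i, A i) ≤ ⨆ i, M s (A i) := by
  refine ENNReal.le_of_forall_pos_le_add fun ε hε hfin => ?_
  obtain ⟨ε', hε', hsum⟩ := ENNReal.exists_pos_sum_of_countable (ε := ε)
    (by exact_mod_cast hε.ne') ℕ
  have hfi : ∀ i, M s (A i) ≠ ∞ := fun i => ((le_iSup (fun i => M s (A i)) i).trans_lt hfin).ne
  have hlt : ∀ i, M s (A i) < M s (A i) + ε' i := fun i =>
    ENNReal.lt_add_right (hfi i) (by exact_mod_cast (hε' i).ne')
  choose C hC hc using fun i => exists_cov (hlt i)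
  let E : ℕ → Set (W d) := fun k => Nat.rec (C 0) (fun k Ek => Mx (Ek ∪ C (k+1))) k
  have E0 : E 0 = C 0 := rfl
  have Es : ∀ k, E (k+1) = Mx (E k ∪ C (k+1)) := fun k => rfl
  have hEcov : ∀ k, A k ⊆ Cov (E k) := by
    intro k
    cases k with
    | zero => exact hC 0
    | succ k =>
      rw [Es]
      refine Subset.trans ?_ (Cov_Mx _)
      intro x hx
      obtain ⟨w, hw, h⟩ := hC (k+1) hx
      exact ⟨w, Or.inr hw, h⟩
  have hEsub : ∀ k, E k ⊆ ⋃ i, C i := by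
    intro k
    induction k with
    | zero => exact subset_iUnion C 0
    | succ k ih =>
      rw [Es]
      exact (Mx_subset _).trans (union_subset ih (subset_iUnion C (k+1)))
  have hcost : ∀ k, cost s (E k) ≤ M s (A k) + ∑ i ∈ Finset.range (k+1), (ε' i : ℝ≥0∞) := by
    intro k
    induction k with
    | zero => simpa [E0] using (hc 0).le
    | succ k ih =>
      have h1 := strong_sub (s := s) (hEcov k) ((hA (Nat.le_succ k)).trans (hC (k+1)))
      rw [← Es] at h1
      have h2 : cost s (E (k+1)) + M s (A k) ≤
          (M s (A (k+1)) + ∑ i ∈ Finset.range (k+1+1), (ε' i : ℝ≥0∞)) + M s (A k) := by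
        refine h1.trans ((add_le_add ih (hc (k+1)).le).trans (le_of_eq ?_))
        rw [Finset.sum_range_succ _ (k+1)]
        ring
      exact (ENNReal.add_le_add_iff_right (hfi k)).1 h2
  set X := Mx (⋃ i, C i) with hX
  have hXk : ∀ k, X ∩ (accumulate C k) ⊆ E k := by
    intro k
    induction k with
    | zero =>
      rintro w ⟨_, hw⟩
      simpa [accumulate, E0] using hw
    | succ k ih =>
      rintro w ⟨hw, hw'⟩
      rw [Es]
      refine Mx_anti (union_subset (hEsub k) (subset_iUnion C (k+1))) hw ?_
      rw [accumulate_succ] at hw'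
      rcases hw' with h | h
      · exact Or.inl (ih ⟨hw, h⟩)
      · exact Or.inr h
  have hXU : X = ⋃ k, X ∩ accumulate C k := by
    rw [← inter_iUnion, iUnion_accumulate, inter_eq_self_of_subset_left (Mx_subset _)]
  have hXc : cost s X ≤ (⨆ i, M s (A i)) + ε := by
    rw [hXU, Monotone.measure_iUnion]
    · refine iSup_le fun k => ((measure_mono (hXk k)).trans (hcost k)).trans ?_
      refine add_le_add (le_iSup (fun i => M s (A i)) k) ?_
      exact (ENNReal.sum_le_tsum _).trans hsum.le
    · intro i j hij
      exact inter_subset_inter_right _ (monotone_accumulate hij)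
  refine (M_le ?_).trans hXc
  refine Subset.trans ?_ (Cov_Mx _)
  refine iUnion_subset fun i x hx => ?_
  obtain ⟨w, hw, h⟩ := hC i hx
  exact ⟨w, mem_iUnion.2 ⟨i, hw⟩, h⟩


lemma cc_pos {d : ℕ} {s : ℝ} (w : W d) : 0 < cc s w := by
  unfold cc
  refine ENNReal.rpow_pos (ENNReal.pow_pos (by simp) _) ?_
  exact ENNReal.pow_ne_top (by simp)

lemma cc_ne_top {d : ℕ} {s : ℝ} (hs : 0 ≤ s) (w : W d) : cc s w ≠ ∞ := by
  unfold cc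
  exact ENNReal.rpow_ne_top_of_nonneg hs (ENNReal.pow_ne_top (by simp))

lemma hausdorff_zero {d : ℕ} {s : ℝ} (hs : 0 < s) {A : Set (Fin d → ℝ)} (h : M s A = 0) :
    μH[s] A = 0 := by
  have hlt : ∀ j : ℕ, M s A < ((2⁻¹ : ℝ≥0∞) ^ j) ^ s := by
    intro j
    rw [h]
    exact cc_pos (d := d) (s := s) (j, 0)
  choose S hS hc using fun j => exists_cov (hlt j)
  have ht : Tendsto (fun j : ℕ => (2⁻¹ : ℝ≥0∞) ^ j) atTop (𝓝 0) :=
    ENNReal.tendsto_pow_atTop_nhds_zero_of_lt_one (by simp)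
  have ht2 : Tendsto (fun j : ℕ => ((2⁻¹ : ℝ≥0∞) ^ j) ^ s) atTop (𝓝 0) := by
    have := (ENNReal.continuous_rpow_const (y := s)).tendsto 0 |>.comp ht
    simpa [Function.comp_def, ENNReal.zero_rpow_of_pos hs] using this
  have key := Measure.hausdorffMeasure_le_liminf_tsum (ι := fun j => S j) s A _ ht
    (fun j w => Q w.1) ?_ ?_
  · have h2 : liminf (fun j => ∑' w : S j, Metric.ediam (Q w.1) ^ s) atTop ≤
        liminf (fun j : ℕ => ((2⁻¹ : ℝ≥0∞) ^ j) ^ s) atTop := by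
      refine liminf_le_liminf (Eventually.of_forall fun j => ?_)
      refine le_trans ?_ (hc j).le
      rw [cost_eq_tsum]
      exact ENNReal.tsum_le_tsum fun w => ENNReal.rpow_le_rpow (ediam_Q w.1) hs.le
    rw [ht2.liminf_eq] at h2
    exact le_antisymm (key.trans h2) bot_le
  · refine Eventually.of_forall fun j w => (ediam_Q w.1).trans ?_
    have h1 := (cc_le_cost s w.2).trans (hc j).le
    exact (ENNReal.rpow_le_rpow_iff hs).1 h1
  · refine Eventually.of_forall fun j x hx => ?_
    obtain ⟨w, hw, hxw⟩ := hS j hx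
    exact mem_iUnion.2 ⟨⟨w, hw⟩, hxw⟩

/-- neighbour offsets -/
noncomputable def nb (d : ℕ) : Finset (Fin d → ℤ) := Fintype.piFinset fun _ => Finset.Icc (-1) 1

/-- open neighbourhood of the cube -/
def O {d : ℕ} (w : W d) : Set (Fin d → ℝ) :=
  {x | ∀ i, (w.2 i : ℝ) - 1 < 2 ^ w.1 * x i ∧ 2 ^ w.1 * x i < w.2 i + 2}

lemma isOpen_O {d : ℕ} (w : W d) : IsOpen (O w) := by
  have : O w = ⋂ i, {x : Fin d → ℝ | (w.2 i : ℝ) - 1 < 2 ^ w.1 * x i ∧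
      2 ^ w.1 * x i < w.2 i + 2} := by
    ext x; simp [O]
  rw [this]
  refine isOpen_iInter_of_finite fun i => ?_
  have hc : Continuous fun x : Fin d → ℝ => (2:ℝ) ^ w.1 * x i := by fun_prop
  exact (isOpen_lt continuous_const hc).inter (isOpen_lt hc continuous_const)

lemma Q_subset_O {d : ℕ} (w : W d) : Q w ⊆ O w := by
  intro x hx i
  have h : ⌊2 ^ w.1 * x i⌋ = w.2 i := congrFun hx i
  rw [Int.floor_eq_iff] at h
  constructor <;> linarith [h.1, h.2]

lemma O_subset {d : ℕ} (w : W d) : O w ⊆ ⋃ e : nb d, Q (w.1, w.2 + e.1) := by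
  intro x hx
  refine mem_iUnion.2 ⟨⟨cidx w.1 x - w.2, ?_⟩, ?_⟩
  · simp only [nb, Fintype.mem_piFinset, Finset.mem_Icc]
    intro i
    obtain ⟨h1, h2⟩ := hx i
    have a1 : w.2 i - 1 ≤ cidx w.1 x i := by
      unfold cidx; rw [Int.le_floor]; push_cast; exact h1.le
    have a2 : cidx w.1 x i < w.2 i + 2 := by
      unfold cidx; rw [Int.floor_lt]; push_cast; exact h2
    simp only [Pi.sub_apply]
    omega
  · simp [Q]

lemma ball_subset_O {d : ℕ} (k : ℕ) (x : Fin d → ℝ) :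
    Metric.ball x ((2⁻¹ : ℝ) ^ k) ⊆ O (k, cidx k x) := by
  intro y hy i
  have h := (dist_le_pi_dist y x i).trans_lt (Metric.mem_ball.1 hy)
  rw [Real.dist_eq, inv_pow, ← one_div, lt_div_iff₀ (by positivity)] at h
  have h3 : |2 ^ k * y i - 2 ^ k * x i| < 1 := by
    rw [← mul_sub, abs_mul, abs_of_pos (by positivity : (0:ℝ) < 2 ^ k)]; linarith
  rw [abs_lt] at h3
  have h1 := Int.floor_le (2 ^ k * x i)
  have h2 := Int.lt_floor_add_one (2 ^ k * x i)
  simp only [cidx]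
  constructor <;> linarith [h3.1, h3.2]

lemma M_O_le {d : ℕ} {s : ℝ} (w : W d) : M s (O w) ≤ (nb d).card * cc s w := by
  calc M s (O w) ≤ ∑' e : nb d, M s (Q (w.1, w.2 + e.1)) :=
        (M_mono (O_subset w)).trans (M_iUnion_le _)
    _ ≤ ∑' e : nb d, cc s w := ENNReal.tsum_le_tsum fun e => M_Q_le _
    _ = _ := by simp [tsum_fintype]

/-- capacitability -/
lemma exists_compact {d : ℕ} {s : ℝ} {B : Set (Fin d → ℝ)} (hB : MeasurableSet B)
    (hpos : 0 < M s B) : ∃ K ⊆ B, IsCompact K ∧ 0 < M s K := by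
  have han := hB.analyticSet
  rw [AnalyticSet] at han
  rcases han with rfl | ⟨f, hf, rfl⟩
  · simp [M_empty] at hpos
  obtain ⟨θ, hθ0, hθ⟩ := exists_between hpos
  have step : ∀ (T : Set (ℕ → ℕ)) (k : ℕ), ∃ N : ℕ, θ < M s (f '' T) →
      θ < M s (f '' (T ∩ {σ | σ k ≤ N})) := by
    intro T k
    by_cases hT : θ < M s (f '' T)
    · have hU : f '' T = ⋃ N : ℕ, f '' (T ∩ {σ | σ k ≤ N}) := by
        rw [← image_iUnion, ← inter_iUnion]
        congr 1
        refine (inter_eq_self_of_subset_left fun σ _ => ?_).symm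
        exact mem_iUnion.2 ⟨σ k, le_refl (σ k)⟩
      have hm : Monotone fun N : ℕ => f '' (T ∩ {σ | σ k ≤ N}) := by
        intro a b hab
        exact image_mono (inter_subset_inter_right _ fun σ (h : σ k ≤ a) => h.trans hab)
      have := hT.trans_le (hU ▸ M_iUnion_mono hm)
      obtain ⟨N, hN⟩ := lt_iSup_iff.1 this
      exact ⟨N, fun _ => hN⟩
    · exact ⟨0, fun h => absurd h hT⟩
  choose g hg using step
  let T : ℕ → Set (ℕ → ℕ) := fun k => Nat.rec univ (fun k T => T ∩ {σ | σ k ≤ g T k}) k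
  have Ts : ∀ k, T (k+1) = T k ∩ {σ | σ k ≤ g (T k) k} := fun k => rfl
  have hT : ∀ k, θ < M s (f '' (T k)) := by
    intro k
    induction k with
    | zero => simpa [T] using hθ
    | succ k ih => rw [Ts]; exact hg _ _ ih
  let N : ℕ → ℕ := fun k => g (T k) k
  have hTk : ∀ k σ, σ ∈ T k → ∀ i < k, σ i ≤ N i := by
    intro k
    induction k with
    | zero => intro σ _ i hi; omega
    | succ k ih =>
      intro σ hσ i hi
      rw [Ts] at hσ
      rcases Nat.lt_succ_iff_lt_or_eq.1 hi with h | rfl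
      · exact ih σ hσ.1 i h
      · exact hσ.2
  let P : Set (ℕ → ℕ) := Set.pi univ fun i => Iic (N i)
  have hP : IsCompact P := isCompact_univ_pi fun i => (finite_Iic (N i)).isCompact
  have hopen : ∀ V : Set (Fin d → ℝ), IsOpen V → f '' P ⊆ V → θ ≤ M s V := by
    intro V hV hPV
    by_contra hlt
    have hne : ∀ k, ∃ σ ∈ T k, f σ ∉ V := by
      intro k
      by_contra! hcon
      exact hlt ((hT k).le.trans (M_mono (image_subset_iff.2 hcon)))
    choose σ hσT hσV using hne
    let τ : ℕ → ℕ → ℕ := fun k i => min (σ k i) (N i)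
    have hτ : ∀ k, τ k ∈ P := fun k i _ => min_le_right (σ k i) (N i)
    obtain ⟨a, haP, φ, hφ, hlim⟩ := hP.tendsto_subseq hτ
    have hlim2 : Tendsto (σ ∘ φ) atTop (𝓝 a) := by
      rw [tendsto_pi_nhds] at hlim ⊢
      intro i
      refine (hlim i).congr' ?_
      filter_upwards [eventually_gt_atTop i] with k hk
      exact min_eq_left (hTk (φ k) _ (hσT _) i (hk.trans_le (hφ.id_le k)))
    have hc : Tendsto (fun k => f (σ (φ k))) atTop (𝓝 (f a)) := (hf.tendsto a).comp hlim2
    have := hV.isClosed_compl.mem_of_tendsto hc (Eventually.of_forall fun k => hσV (φ k))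
    exact this (hPV ⟨a, haP, rfl⟩)
  refine ⟨f '' P, image_subset_range _ _, hP.image hf, ?_⟩
  rw [pos_iff_ne_zero]
  intro h0
  have hcard : ((nb d).card : ℝ≥0∞) ≠ ∞ := ENNReal.natCast_ne_top _
  obtain ⟨t, ht0, ht⟩ : ∃ t : ℝ≥0∞, 0 < t ∧ (nb d).card * t < θ := by
    obtain ⟨c, hc, h⟩ := ENNReal.exists_pos_mul_lt hcard hθ0.ne'
    exact ⟨c, hc, by rwa [mul_comm]⟩
  obtain ⟨S, hS, hc⟩ := exists_cov (h0.trans_lt ht0 : M s (f '' P) < t)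
  have := hopen (⋃ w : S, O w.1) (isOpen_iUnion fun w => isOpen_O _) (by
    intro x hx
    obtain ⟨w, hw, hxw⟩ := hS hx
    exact mem_iUnion.2 ⟨⟨w, hw⟩, Q_subset_O w hxw⟩)
  refine absurd this (not_le.2 ?_)
  calc M s (⋃ w : S, O w.1) ≤ ∑' w : S, M s (O w.1) := M_iUnion_le _
    _ ≤ ∑' w : S, (nb d).card * cc s w.1 := ENNReal.tsum_le_tsum fun w => M_O_le _
    _ = (nb d).card * cost s S := by rw [ENNReal.tsum_mul_left, cost_eq_tsum]
    _ ≤ (nb d).card * t := by gcongr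
    _ < θ := ht


def par {d : ℕ} (z : Fin d → ℤ) : Fin d → ℤ := fun i => z i / 2

lemma cidx_par {d : ℕ} (k : ℕ) (x : Fin d → ℝ) : cidx k x = par (cidx (k+1) x) :=
  funext fun i => cidx_succ k x i

instance finite_children {d : ℕ} (p : Fin d → ℤ) : Finite {z : Fin d → ℤ // par z = p} := by
  have : {z : Fin d → ℤ | par z = p}.Finite := by
    refine (Set.finite_Icc (fun i => 2 * p i) (fun i => 2 * p i + 1)).subset ?_
    intro z hz
    have h : ∀ i, z i / 2 = p i := fun i => congrFun hz i
    constructor <;> intro i <;> have := h i <;> simp only <;> omega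
  exact this

lemma level_step {d : ℕ} {s : ℝ} (hs : 0 ≤ s) {K : Set (Fin d → ℝ)} (hKm : MeasurableSet K)
    (hKne : K.Nonempty) (k : ℕ) (ν : Measure (Fin d → ℝ))
    (hν : ∀ z, ν (Q (k, z)) ≤ M s (K ∩ Q (k, z))) :
    ∃ ν' : Measure (Fin d → ℝ), ν' Kᶜ = 0 ∧ ν'.map (cidx k) = ν.map (cidx k) ∧
      ∀ z, ν' (Q (k+1, z)) ≤ M s (K ∩ Q (k+1, z)) := by
  classical
  have hx : ∀ z : Fin d → ℤ, ∃ x ∈ K, (K ∩ Q (k+1, z)).Nonempty → x ∈ Q (k+1, z) := by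
    intro z
    by_cases h : (K ∩ Q (k+1, z)).Nonempty
    · obtain ⟨x, h1, h2⟩ := h; exact ⟨x, h1, fun _ => h2⟩
    · obtain ⟨x, h1⟩ := hKne; exact ⟨x, h1, fun h' => absurd h' h⟩
  choose x hxK hxQ using hx
  let a : (Fin d → ℤ) → ℝ≥0∞ := fun z => M s (K ∩ Q (k+1, z))
  have ha : ∀ z, a z ≠ ∞ := fun z =>
    ne_top_of_le_ne_top (cc_ne_top hs _) ((M_mono inter_subset_right).trans (M_Q_le _))
  have hxa : ∀ z, a z ≠ 0 → cidx (k+1) (x z) = z := by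
    intro z hz
    refine hxQ z ?_
    by_contra hne
    rw [not_nonempty_iff_eq_empty] at hne
    exact hz (by simp only [a, hne, M_empty])
  let T : (Fin d → ℤ) → ℝ≥0∞ := fun p => ∑' z : {z // par z = p}, a z.1
  have hT : ∀ p, T p ≠ ∞ := by
    intro p
    have := Fintype.ofFinite {z : Fin d → ℤ // par z = p}
    simp only [T]
    rw [tsum_fintype]
    exact ENNReal.sum_ne_top.2 fun z _ => ha z.1
  have hνT : ∀ p, ν (Q (k, p)) ≤ T p := by
    intro p
    refine (hν p).trans (le_trans (M_mono ?_) (M_iUnion_le _))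
    rintro y ⟨hy, hyQ⟩
    refine mem_iUnion.2 ⟨⟨cidx (k+1) y, ?_⟩, hy, rfl⟩
    rw [← cidx_par]; exact hyQ
  let b : (Fin d → ℤ) → ℝ≥0∞ := fun z => ν (Q (k, par z)) * (a z / T (par z))
  have hba : ∀ z, b z ≤ a z := fun z =>
    (mul_le_mul_left (hνT _) _).trans ENNReal.mul_div_le
  have hb0 : ∀ z, b z ≠ 0 → cidx (k+1) (x z) = z := fun z hz =>
    hxa z fun h => hz (le_antisymm ((hba z).trans h.le) bot_le)
  let ν' : Measure (Fin d → ℝ) := Measure.sum fun z => b z • Measure.dirac (x z)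
  have happ : ∀ S, MeasurableSet S → ν' S = ∑' z, b z * S.indicator 1 (x z) := by
    intro S hS
    simp only [ν']
    rw [Measure.sum_apply _ hS]
    refine tsum_congr fun z => ?_
    rw [Measure.smul_apply, Measure.dirac_apply' _ hS, smul_eq_mul]
  refine ⟨ν', ?_, ?_, ?_⟩
  · rw [happ _ hKm.compl, ENNReal.tsum_eq_zero]
    intro z
    simp [hxK z]
  · refine Measure.ext_of_singleton fun p => ?_
    rw [Measure.map_apply (measurable_cidx k) (measurableSet_singleton _),
      Measure.map_apply (measurable_cidx k) (measurableSet_singleton _)]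
    change ν' (Q (k, p)) = ν (Q (k, p))
    rw [happ _ (measurableSet_Q _)]
    have h1 : ∀ z, b z * (Q (k, p)).indicator 1 (x z) =
        ({z | par z = p} : Set (Fin d → ℤ)).indicator (fun z => ν (Q (k, p)) * (a z / T p)) z := by
      intro z
      by_cases hz : b z = 0
      · rw [hz, zero_mul]
        by_cases hp : par z = p
        · rw [indicator_of_mem (by exact hp)]
          simp only [b, hp] at hz
          exact hz.symm
        · rw [indicator_of_notMem (by exact hp)]
      · have h2 : cidx k (x z) = par z := by rw [cidx_par, hb0 z hz]
        by_cases hp : par z = p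
        · rw [indicator_of_mem (s := Q (k, p)) (by exact h2.trans hp),
            indicator_of_mem (by exact hp)]
          simp [b, hp]
        · rw [indicator_of_notMem (s := Q (k, p)) (by exact fun h => hp (h2.symm.trans h)),
            indicator_of_notMem (by exact hp), mul_zero]
    rw [tsum_congr h1, ← tsum_subtype, ENNReal.tsum_mul_left]
    have h3 : ∑' z : ({z | par z = p} : Set (Fin d → ℤ)), a z.1 / T p = T p / T p := by
      simp only [div_eq_mul_inv]
      rw [ENNReal.tsum_mul_right]
      rfl
    rw [h3]
    by_cases h0 : T p = 0
    · have : ν (Q (k, p)) = 0 := le_antisymm ((hνT p).trans h0.le) bot_le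
      simp [this]
    · rw [ENNReal.div_self h0 (hT p), mul_one]
  · intro z
    rw [happ _ (measurableSet_Q _), tsum_eq_single z]
    · refine le_trans ?_ (hba z)
      refine mul_le_of_le_one_right' ?_
      exact indicator_apply_le' (fun _ => le_rfl) (fun _ => zero_le_one)
    · intro z' hz'
      by_cases hb : b z' = 0
      · simp [hb]
      · rw [indicator_of_notMem, mul_zero]
        intro h
        have h' : cidx (k+1) (x z') = z := h
        exact hz' ((hb0 z' hb).symm.trans h')

lemma Q_eq_preimage {d : ℕ} {j k : ℕ} (h : j ≤ k) (z : Fin d → ℤ) :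
    Q (j, z) = cidx k ⁻¹' (cidx k '' Q (j, z)) := by
  refine subset_antisymm (subset_preimage_image _ _) ?_
  rintro x ⟨y, hy, hxy⟩
  exact (cidx_eq_le h hxy.symm).trans hy

lemma measure_eq_of_map {d : ℕ} {k : ℕ} {ν ν' : Measure (Fin d → ℝ)}
    (h : ν'.map (cidx k) = ν.map (cidx k)) (S : Set (Fin d → ℤ)) :
    ν' (cidx k ⁻¹' S) = ν (cidx k ⁻¹' S) := by
  rw [← Measure.map_apply (measurable_cidx k) S.to_countable.measurableSet, h,
    Measure.map_apply (measurable_cidx k) S.to_countable.measurableSet]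

lemma level {d : ℕ} {s : ℝ} (hs : 0 ≤ s) {K : Set (Fin d → ℝ)} (hKm : MeasurableSet K)
    (hKne : K.Nonempty) (z0 : Fin d → ℤ) (hKz : K ⊆ Q (0, z0)) (k : ℕ) :
    ∃ ν : Measure (Fin d → ℝ), ν Kᶜ = 0 ∧ ν univ = M s K ∧
      ∀ j ≤ k, ∀ z, ν (Q (j, z)) ≤ M s (K ∩ Q (j, z)) := by
  induction k with
  | zero =>
    obtain ⟨x, hx⟩ := hKne
    refine ⟨M s K • Measure.dirac x, ?_, ?_, ?_⟩
    · simp [Measure.dirac_apply' _ hKm.compl, hx]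
    · simp
    · intro j hj z
      obtain rfl : j = 0 := by omega
      rw [Measure.smul_apply, Measure.dirac_apply' _ (measurableSet_Q _), smul_eq_mul]
      by_cases hxz : x ∈ Q (0, z)
      · have hz : z0 = z := (hKz hx).symm.trans hxz
        subst hz
        rw [inter_eq_self_of_subset_left hKz]
        simp [hxz]
      · simp [hxz]
  | succ k ih =>
    obtain ⟨ν, h1, h2, h3⟩ := ih
    obtain ⟨ν', h1', h2', h3'⟩ := level_step hs hKm hKne k ν (h3 k le_rfl)
    refine ⟨ν', h1', ?_, ?_⟩
    · have := measure_eq_of_map h2' univ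
      rw [preimage_univ] at this
      rw [this, h2]
    · intro j hj z
      rcases Nat.lt_or_ge k j with h | h
      · obtain rfl : j = k + 1 := by omega
        exact h3' z
      · rw [Q_eq_preimage h z, measure_eq_of_map h2', ← Q_eq_preimage h z]
        exact h3 j h z

lemma frostman {d : ℕ} {s : ℝ} (hs : 0 < s) {A : Set (Fin d → ℝ)} (hA : MeasurableSet A)
    (hH : μH[s] A ≠ 0) :
    ∃ K ⊆ A, IsCompact K ∧ ∃ μ : Measure (Fin d → ℝ), IsProbabilityMeasure μ ∧ μ Kᶜ = 0 ∧
      ∃ C : ℝ≥0∞, C ≠ ∞ ∧ ∀ x (k : ℕ),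
        μ (Metric.ball x ((2⁻¹ : ℝ) ^ k)) ≤ C * ((2⁻¹ : ℝ≥0∞) ^ k) ^ s := by
  have hMA : M s A ≠ 0 := fun h => hH (hausdorff_zero hs h)
  obtain ⟨z0, hz0⟩ : ∃ z0, M s (A ∩ Q (0, z0)) ≠ 0 := by
    by_contra! h
    apply hMA
    have hsub : A ⊆ ⋃ z : Fin d → ℤ, A ∩ Q (0, z) := fun x hx => mem_iUnion.2 ⟨cidx 0 x, hx, mem_Q_self 0 x⟩
    have := (M_mono hsub).trans (M_iUnion_le (s := s) _)
    simpa [h] using this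
  obtain ⟨K, hKA, hK, hMK⟩ := exists_compact (hA.inter (measurableSet_Q _)) hz0.bot_lt
  have hKne : K.Nonempty := by
    rw [nonempty_iff_ne_empty]; rintro rfl; simp [M_empty] at hMK
  have hKz : K ⊆ Q (0, z0) := fun x hx => (hKA hx).2
  have hMt : M s K ≠ ∞ :=
    ne_top_of_le_ne_top (cc_ne_top hs.le (0, z0)) ((M_mono hKz).trans (M_Q_le _))
  choose ν hν1 hν2 hν3 using level hs.le hK.measurableSet hKne z0 hKz
  have hp : ∀ k, IsProbabilityMeasure ((M s K)⁻¹ • ν k) := fun k => ⟨by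
    rw [Measure.smul_apply, hν2, smul_eq_mul, ENNReal.inv_mul_cancel hMK.ne' hMt]⟩
  let P : ℕ → ProbabilityMeasure (Fin d → ℝ) := fun k => ⟨(M s K)⁻¹ • ν k, hp k⟩
  have hPapp : ∀ k S, (P k : Measure (Fin d → ℝ)) S = (M s K)⁻¹ * ν k S := fun k S => rfl
  have hcomp := isCompact_setOfPred_probabilityMeasure_mass_eq_compl_isCompact_le
    (E := Fin d → ℝ) (u := fun _ => 0) (K := fun _ => K) tendsto_const_nhds (fun _ => hK)
    (Or.inr monotone_const)
  have hPmem : ∀ k, P k ∈ {μ : ProbabilityMeasure (Fin d → ℝ) | ∀ n : ℕ, μ Kᶜ ≤ 0} := by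
    intro k _
    have : (P k : Measure (Fin d → ℝ)) Kᶜ = 0 := by rw [hPapp, hν1, mul_zero]
    exact (ProbabilityMeasure.null_iff_toMeasure_null _ _).2 this |>.le
  obtain ⟨μ, hμ, hlim⟩ := hcomp.ultrafilter_le_nhds ((hyperfilter ℕ).map P)
    (by rw [le_principal_iff]; exact univ_mem' (f := (hyperfilter ℕ : Filter ℕ)) hPmem)
  have hlim' : Tendsto P (hyperfilter ℕ : Filter ℕ) (𝓝 μ) := hlim
  refine ⟨K, fun x hx => (hKA hx).1, hK, μ, inferInstance, ?_, (M s K)⁻¹ * (nb d).card, ?_, ?_⟩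
  · exact (ProbabilityMeasure.null_iff_toMeasure_null _ _).1 (le_antisymm (hμ 0) bot_le)
  · exact ENNReal.mul_ne_top (ENNReal.inv_ne_top.2 hMK.ne') (ENNReal.natCast_ne_top _)
  · intro x k
    refine (ProbabilityMeasure.le_liminf_measure_open_of_tendsto hlim' Metric.isOpen_ball).trans ?_
    have hev : ∀ᶠ i in (hyperfilter ℕ : Filter ℕ), k ≤ i :=
      (Nat.hyperfilter_le_atTop (eventually_ge_atTop k))
    refine liminf_le_of_frequently_le' (Eventually.frequently (hev.mono fun i hi => ?_))
    rw [hPapp, mul_assoc]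
    gcongr
    calc ν i (Metric.ball x ((2⁻¹ : ℝ) ^ k))
        ≤ ∑' e : nb d, ν i (Q (k, cidx k x + e.1)) :=
          (measure_mono ((ball_subset_O k x).trans (O_subset _))).trans (measure_iUnion_le _)
      _ ≤ ∑' e : nb d, cc s (k, cidx k x) := by
          refine ENNReal.tsum_le_tsum fun e => (hν3 i k hi _).trans ?_
          exact (M_mono inter_subset_right).trans (M_Q_le _)
      _ = _ := by simp [tsum_fintype, cc]


lemma iInter_Q {d : ℕ} (x : Fin d → ℝ) : ⋂ k, Q (k, cidx k x) = {x} := by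
  refine subset_antisymm (fun y hy => ?_) (by rintro _ rfl; exact mem_iInter.2 fun k => rfl)
  rw [mem_iInter] at hy
  have h : ∀ k : ℕ, dist y x ≤ (2⁻¹ : ℝ) ^ k := fun k => dist_le_of_cidx_eq (hy k)
  have ht : Tendsto (fun k : ℕ => (2⁻¹ : ℝ) ^ k) atTop (𝓝 0) :=
    tendsto_pow_atTop_nhds_zero_of_lt_one (by norm_num) (by norm_num)
  exact dist_le_zero.1 (ge_of_tendsto' ht h)

lemma exists_Q_lt {d : ℕ} (η : Measure (Fin d → ℝ)) [IsFiniteMeasure η] (x : Fin d → ℝ)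
    (hx : η {x} ≠ 0) : ∃ w : W d, x ∈ Q w ∧ η (Q w) < 2 * η {x} := by
  have hanti : Antitone fun k => Q (k, cidx k x) := by
    intro a b hab y hy
    exact cidx_eq_le hab hy
  have ht := tendsto_measure_iInter_atTop (μ := η)
    (fun k => (measurableSet_Q (k, cidx k x)).nullMeasurableSet) hanti
    ⟨0, measure_ne_top _ _⟩
  rw [iInter_Q] at ht
  have hlt : η {x} < 2 * η {x} := by
    rw [two_mul]; exact ENNReal.lt_add_right (measure_ne_top _ _) hx
  obtain ⟨k, hk⟩ := (ht.eventually_lt_const hlt).exists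
  exact ⟨(k, cidx k x), rfl, hk⟩

lemma exists_inj {d m : ℕ} (μ : Measure (Fin d → ℝ)) [IsProbabilityMeasure μ]
    {K : Set (Fin d → ℝ)} (hK : IsCompact K) (hμK : μ Kᶜ = 0)
    (π : (Fin d → ℝ) → (Fin m → ℝ)) (hπ : Continuous π)
    (hcount : ∀ a, (K ∩ π ⁻¹' {a}).Countable) :
    ∃ A ⊆ K, IsCompact A ∧ μ A ≠ 0 ∧ InjOn π A := by
  have hg : Measurable fun x => (π x, x) := hπ.measurable.prodMk measurable_id
  let ρ : Measure ((Fin m → ℝ) × (Fin d → ℝ)) := μ.map fun x => (π x, x)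
  have : IsProbabilityMeasure ρ := Measure.isProbabilityMeasure_map hg.aemeasurable
  let κ := ρ.condKernel
  have hdis : ρ.fst ⊗ₘ κ = ρ := ρ.disintegrate ρ.condKernel
  have hρ : ∀ S, MeasurableSet S → ρ S = ∫⁻ a, κ a (Prod.mk a ⁻¹' S) ∂ρ.fst := by
    intro S hS
    conv_lhs => rw [← hdis]
    rw [Measure.compProd_apply hS]
  have hmeas : Measurable fun p : (Fin m → ℝ) × (Fin d → ℝ) => κ p.1 {p.2} := by
    have ht : MeasurableSet {q : ((Fin m → ℝ) × (Fin d → ℝ)) × (Fin d → ℝ) | q.2 = q.1.2} :=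
      measurableSet_eq_fun measurable_snd (measurable_snd.comp measurable_fst)
    have := Kernel.measurable_kernel_prodMk_left (κ := κ.comap Prod.fst measurable_fst) ht
    exact this
  let N : Set ((Fin m → ℝ) × (Fin d → ℝ)) := {p | κ p.1 {p.2} = 0}
  have hN : MeasurableSet N := hmeas (measurableSet_singleton 0)
  let G : Set ((Fin m → ℝ) × (Fin d → ℝ)) := {p | p.2 ∈ K ∧ π p.2 = p.1}
  have hG : MeasurableSet G :=
    (measurable_snd hK.measurableSet).inter
      (measurableSet_eq_fun (hπ.measurable.comp measurable_snd) measurable_fst)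
  have hρG : ρ Gᶜ = 0 := by
    rw [Measure.map_apply hg hG.compl]
    convert hμK using 2
    ext x; simp [G]
  have hρN : ρ N = 0 := by
    rw [hρ _ hG.compl, lintegral_eq_zero_iff (Kernel.measurable_kernel_prodMk_left hG.compl)] at hρG
    rw [hρ _ hN, lintegral_eq_zero_iff (Kernel.measurable_kernel_prodMk_left hN)]
    filter_upwards [hρG] with a ha
    have h1 : Prod.mk a ⁻¹' N ⊆
        (Prod.mk a ⁻¹' Gᶜ) ∪ ({x | κ a {x} = 0} ∩ (K ∩ π ⁻¹' {a})) := by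
      intro x hx
      by_cases hxG : (a, x) ∈ G
      · exact Or.inr ⟨hx, hxG⟩
      · exact Or.inl hxG
    refine measure_mono_null h1 (measure_union_null ha ?_)
    have hc : ({x | κ a {x} = 0} ∩ (K ∩ π ⁻¹' {a})).Countable :=
      (hcount a).mono inter_subset_right
    rw [← biUnion_of_singleton ({x | κ a {x} = 0} ∩ (K ∩ π ⁻¹' {a})),
      measure_biUnion_null_iff hc]
    exact fun x hx => hx.1
  have hμN : μ {x | κ (π x) {x} = 0} = 0 := by
    rw [Measure.map_apply hg hN] at hρN
    exact hρN
  let A : W d → Set (Fin d → ℝ) := fun w =>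
    {x | κ (π x) (Q w) < 2 * κ (π x) {x}} ∩ Q w ∩ K
  have hAm : ∀ w, MeasurableSet (A w) := by
    intro w
    refine MeasurableSet.inter (MeasurableSet.inter ?_ (measurableSet_Q w)) hK.measurableSet
    refine measurableSet_lt ?_ ?_
    · exact (Kernel.measurable_coe κ (measurableSet_Q w)).comp hπ.measurable
    · exact (hmeas.comp hg).const_mul _
  obtain ⟨w, hw⟩ : ∃ w, μ (A w) ≠ 0 := by
    by_contra! h
    have hcov : univ ⊆ Kᶜ ∪ ({x | κ (π x) {x} = 0} ∪ ⋃ w, A w) := by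
      intro x _
      by_cases hxK : x ∈ K
      · by_cases hx : κ (π x) {x} = 0
        · exact Or.inr (Or.inl hx)
        · obtain ⟨w, h1, h2⟩ := exists_Q_lt (κ (π x)) x hx
          exact Or.inr (Or.inr (mem_iUnion.2 ⟨w, ⟨h2, h1⟩, hxK⟩))
      · exact Or.inl hxK
    have := measure_mono_null hcov
      (measure_union_null hμK (measure_union_null hμN (measure_iUnion_null h)))
    simp at this
  obtain ⟨A', hA', hA'c, hA'pos⟩ := (hAm w).exists_lt_isCompact (μ := μ) hw.bot_lt
  refine ⟨A', fun x hx => (hA' hx).2, hA'c, hA'pos.ne', ?_⟩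
  intro x hx y hy hxy
  by_contra hne
  have h1 : κ (π x) (Q w) < 2 * κ (π x) {x} := (hA' hx).1.1
  have h2 : κ (π x) (Q w) < 2 * κ (π x) {y} := by
    have : κ (π y) (Q w) < 2 * κ (π y) {y} := (hA' hy).1.1
    rwa [← hxy] at this
  have h3 : κ (π x) {x} + κ (π x) {y} ≤ κ (π x) (Q w) := by
    rw [← measure_union (by simpa using hne) (measurableSet_singleton y)]
    refine measure_mono ?_
    rintro z (rfl | rfl)
    · exact (hA' hx).1.2
    · exact (hA' hy).1.2
  have h4 := ENNReal.add_lt_add h1 h2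
  rw [← mul_add, ← two_mul] at h4
  exact absurd (mul_le_mul_right h3 2) (not_le.2 h4)

lemma unif {d m : ℕ} {A : Set (Fin d → ℝ)} (hA : IsCompact A)
    (π : (Fin d → ℝ) → (Fin m → ℝ)) (hπ : Continuous π) (hinj : InjOn π A) {r : ℝ} (hr : 0 < r) :
    ∃ δ > 0, ∀ x ∈ A, ∀ y ∈ A, dist (π x) (π y) < δ → dist x y < r := by
  let C : Set ((Fin d → ℝ) × (Fin d → ℝ)) := (A ×ˢ A) ∩ {p | r ≤ dist p.1 p.2}
  have hC : IsCompact C := (hA.prod hA).inter_right (isClosed_le (by fun_prop) (by fun_prop))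
  rcases C.eq_empty_or_nonempty with h | h
  · refine ⟨1, one_pos, fun x hx y hy _ => ?_⟩
    by_contra hcon
    have : (x, y) ∈ C := ⟨⟨hx, hy⟩, not_lt.1 hcon⟩
    rw [h] at this; exact this
  · obtain ⟨p, hp, hmin⟩ := hC.exists_isMinOn h
      (f := fun p => dist (π p.1) (π p.2)) (by fun_prop)
    refine ⟨dist (π p.1) (π p.2), ?_, fun x hx y hy hxy => ?_⟩
    · rw [gt_iff_lt, dist_pos]
      intro he
      have h2 := hinj hp.1.1 hp.1.2 he
      have h3 : r ≤ dist p.1 p.2 := hp.2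
      rw [h2, dist_self] at h3
      linarith
    · by_contra hcon
      have hm : (x, y) ∈ C := ⟨⟨hx, hy⟩, not_lt.1 hcon⟩
      exact absurd (isMinOn_iff.1 hmin _ hm) (not_le.2 hxy)

lemma pigeon {d m : ℕ} (μ : Measure (Fin d → ℝ)) [IsProbabilityMeasure μ]
    {A : Set (Fin d → ℝ)} (hA : MeasurableSet A) (π : (Fin d → ℝ) → (Fin m → ℝ))
    (hπ : Measurable π) (L : ℕ) (hL : ∀ x ∈ A, ∀ i, |π x i| ≤ L) (j : ℕ)
    (S : Set ((Fin d → ℝ) × (Fin d → ℝ)))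
    (hS : ∀ x ∈ A, ∀ y ∈ A, dist (π x) (π y) ≤ (2⁻¹ : ℝ) ^ j → (x, y) ∈ S) :
    μ A ^ 2 ≤ ((2 * L + 1 : ℕ) : ℝ≥0∞) ^ m * ((2 : ℝ≥0∞) ^ j) ^ m * (μ.prod μ) S := by
  classical
  let F : Finset (Fin m → ℤ) := Fintype.piFinset fun _ =>
    Finset.Icc (-((L * 2 ^ j : ℕ) : ℤ)) ((L * 2 ^ j : ℕ) : ℤ)
  have hF : F.card ≤ ((2 * L + 1) * 2 ^ j) ^ m := by
    simp only [F, Fintype.card_piFinset, Int.card_Icc, Finset.prod_const, Finset.card_univ,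
      Fintype.card_fin]
    gcongr
    have : 1 ≤ 2 ^ j := Nat.one_le_two_pow
    have h3 : (((L * 2 ^ j : ℕ) : ℤ) + 1 - -((L * 2 ^ j : ℕ) : ℤ)).toNat
      = 2 * (L * 2 ^ j) + 1 := by omega
    rw [h3]; nlinarith
  let B : (Fin m → ℤ) → Set (Fin d → ℝ) := fun z => A ∩ π ⁻¹' Q (j, z)
  have hB : ∀ z, MeasurableSet (B z) := fun z => hA.inter (hπ (measurableSet_Q _))
  have hAB : A ⊆ ⋃ z ∈ F, B z := by
    intro x hx
    refine mem_biUnion (x := cidx j (π x)) ?_ ⟨hx, rfl⟩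
    simp only [F, Finset.mem_coe, Fintype.mem_piFinset, Finset.mem_Icc]
    intro i
    have h := abs_le.1 (hL x hx i)
    have hp : (0:ℝ) < 2 ^ j := by positivity
    constructor
    · unfold cidx; rw [Int.le_floor]; push_cast; nlinarith [h.1]
    · unfold cidx
      have : (⌊2 ^ j * π x i⌋ : ℝ) ≤ ((L * 2 ^ j : ℕ) : ℤ) := by
        refine (Int.floor_le _).trans ?_
        push_cast; nlinarith [h.2]
      exact_mod_cast this
  have h1 : μ A ≤ ∑ z ∈ F, μ (B z) := (measure_mono hAB).trans (measure_biUnion_finset_le _ _)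
  have h2 : ∑ z ∈ F, μ (B z) ^ 2 ≤ (μ.prod μ) S := by
    have h3 : ∑ z ∈ F, μ (B z) ^ 2 = (μ.prod μ) (⋃ z ∈ F, B z ×ˢ B z) := by
      rw [measure_biUnion_finset]
      · simp [Measure.prod_prod, sq]
      · intro a _ b _ hab
        rw [Function.onFun, Set.disjoint_left]
        rintro ⟨x, y⟩ ⟨⟨_, h1⟩, _⟩ ⟨⟨_, h2⟩, _⟩
        exact hab (Eq.trans (Eq.symm h1) h2)
      · exact fun z _ => (hB z).prod (hB z)
    rw [h3]
    refine measure_mono (iUnion₂_subset fun z _ => ?_)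
    rintro ⟨x, y⟩ ⟨⟨h1, h2⟩, ⟨h3, h4⟩⟩
    exact hS x h1 y h3 (dist_le_of_cidx_eq (Eq.trans h2 (Eq.symm h4)))
  have h4 := ENNReal.rpow_sum_le_const_mul_sum_rpow F (fun z => μ (B z)) (p := 2) (by norm_num)
  have h5 : ((2:ℝ) - 1) = 1 := by norm_num
  rw [h5, ENNReal.rpow_one] at h4
  simp only [ENNReal.rpow_two] at h4
  calc μ A ^ 2 ≤ (∑ z ∈ F, μ (B z)) ^ 2 := by gcongr
    _ ≤ F.card * ∑ z ∈ F, μ (B z) ^ 2 := h4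
    _ ≤ (((2 * L + 1) * 2 ^ j) ^ m : ℕ) * (μ.prod μ) S := by gcongr
    _ = _ := by push_cast; rw [mul_pow]


/-- projection along `(1,u)` -/
def pr {m : ℕ} (u : Fin m → ℝ) (x : Fin (m+1) → ℝ) : Fin m → ℝ := fun i => x i.succ - x 0 * u i

lemma continuous_pr {m : ℕ} :
    Continuous fun p : (Fin m → ℝ) × (Fin (m+1) → ℝ) => pr p.1 p.2 := by
  unfold pr; fun_prop

lemma vol_le {m : ℕ} {R : ℝ} (hR : 0 ≤ R) {x y : Fin (m+1) → ℝ} (hxy : x ≠ y) {δ : ℝ}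
    (hδ : 0 ≤ δ) :
    volume ({u : Fin m → ℝ | dist (pr u x) (pr u y) ≤ δ} ∩ Metric.closedBall 0 R) ≤
      ENNReal.ofReal ((4 * (R + 1) * δ / dist x y) ^ m) := by
  have hd : 0 < dist x y := dist_pos.2 hxy
  rcases ({u : Fin m → ℝ | dist (pr u x) (pr u y) ≤ δ} ∩ Metric.closedBall 0 R).eq_empty_or_nonempty
    with h | ⟨u, hu, huR⟩
  · rw [h]; simp
  have hu' : dist (pr u x) (pr u y) ≤ δ := hu
  have huR' : ‖u‖ ≤ R := by simpa using huR
  have hcomp : ∀ i : Fin m, |(x i.succ - y i.succ) - (x 0 - y 0) * u i| ≤ δ := by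
    intro i
    have h := (dist_le_pi_dist (pr u x) (pr u y) i).trans hu'
    have e : pr u x i - pr u y i = (x i.succ - y i.succ) - (x 0 - y 0) * u i := by
      simp only [pr]; ring
    rwa [Real.dist_eq, e] at h
  have hz : dist x y ≤ δ + (R + 1) * |x 0 - y 0| := by
    rw [dist_pi_le_iff (by positivity)]
    intro i
    rw [Real.dist_eq]
    refine Fin.cases ?_ (fun i => ?_) i
    · nlinarith [abs_nonneg (x 0 - y 0)]
    · have h1 := hcomp i
      have h2 : |u i| ≤ R := (norm_le_pi_norm u i).trans huR'
      have h3 : |x i.succ - y i.succ| ≤ δ + |(x 0 - y 0) * u i| := by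
        have := abs_add_le ((x i.succ - y i.succ) - (x 0 - y 0) * u i) ((x 0 - y 0) * u i)
        rw [sub_add_cancel] at this
        linarith
      rw [abs_mul] at h3
      nlinarith [abs_nonneg (x 0 - y 0)]
  by_cases hc : dist x y ≤ 2 * δ
  · calc _ ≤ volume (Metric.closedBall (0 : Fin m → ℝ) R) := measure_mono inter_subset_right
      _ = ENNReal.ofReal ((2 * R) ^ m) := by
        rw [Real.volume_pi_closedBall _ hR, Fintype.card_fin]
      _ ≤ _ := by
        refine ENNReal.ofReal_le_ofReal (pow_le_pow_left₀ (by positivity) ?_ m)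
        rw [le_div_iff₀ hd]
        nlinarith
  · push Not at hc
    have h0 : dist x y ≤ 2 * (R + 1) * |x 0 - y 0| := by nlinarith
    have hp : 0 < |x 0 - y 0| := by
      by_contra hcon
      have : |x 0 - y 0| = 0 := le_antisymm (not_lt.1 hcon) (abs_nonneg _)
      rw [this] at h0; linarith
    have hne : x 0 - y 0 ≠ 0 := abs_pos.1 hp
    calc _ ≤ volume (Metric.closedBall
            (fun i : Fin m => (x i.succ - y i.succ) / (x 0 - y 0)) (δ / |x 0 - y 0|)) := by
          refine measure_mono fun v hv => ?_
          have hv' : dist (pr v x) (pr v y) ≤ δ := hv.1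
          rw [Metric.mem_closedBall, dist_pi_le_iff (by positivity)]
          intro i
          have h := (dist_le_pi_dist (pr v x) (pr v y) i).trans hv'
          rw [Real.dist_eq] at h ⊢
          rw [le_div_iff₀ hp, ← abs_mul, abs_sub_comm] at *
          convert h using 1
          rw [abs_sub_comm, ← abs_neg]
          congr 1
          simp only [pr]
          field_simp
          ring
      _ = ENNReal.ofReal ((2 * (δ / |x 0 - y 0|)) ^ m) := by
        rw [Real.volume_pi_closedBall _ (by positivity), Fintype.card_fin]
      _ ≤ _ := by
        refine ENNReal.ofReal_le_ofReal (pow_le_pow_left₀ (by positivity) ?_ m)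
        rw [← mul_div_assoc, div_le_div_iff₀ hp hd]
        nlinarith

/-- pairs that are close to each other, with close projections -/
def SS {m : ℕ} (j k : ℕ) : Set ((Fin m → ℝ) × ((Fin (m+1) → ℝ) × (Fin (m+1) → ℝ))) :=
  {q | dist (pr q.1 q.2.1) (pr q.1 q.2.2) ≤ (2⁻¹ : ℝ) ^ j ∧ dist q.2.1 q.2.2 < (2⁻¹ : ℝ) ^ k}

lemma measurableSet_SS {m : ℕ} (j k : ℕ) : MeasurableSet (SS (m := m) j k) := by
  have h1 : Continuous fun q : (Fin m → ℝ) × ((Fin (m+1) → ℝ) × (Fin (m+1) → ℝ)) =>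
      pr q.1 q.2.1 := continuous_pr.comp (by fun_prop : Continuous fun q : (Fin m → ℝ) ×
        ((Fin (m+1) → ℝ) × (Fin (m+1) → ℝ)) => (q.1, q.2.1))
  have h2 : Continuous fun q : (Fin m → ℝ) × ((Fin (m+1) → ℝ) × (Fin (m+1) → ℝ)) =>
      pr q.1 q.2.2 := continuous_pr.comp (by fun_prop : Continuous fun q : (Fin m → ℝ) ×
        ((Fin (m+1) → ℝ) × (Fin (m+1) → ℝ)) => (q.1, q.2.2))
  have h3 : Continuous fun q : (Fin m → ℝ) × ((Fin (m+1) → ℝ) × (Fin (m+1) → ℝ)) =>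
      dist q.2.1 q.2.2 := by fun_prop
  exact (isClosed_le (h1.dist h2) continuous_const).measurableSet.inter
    (isOpen_lt h3 continuous_const).measurableSet

lemma exists_scale {t : ℝ} (ht : 0 < t) {k : ℕ} (hk : t < (2⁻¹ : ℝ) ^ k) :
    ∃ i : ℕ, (2⁻¹ : ℝ) ^ (i + k + 1) ≤ t ∧ t < (2⁻¹ : ℝ) ^ (i + k) := by
  classical
  have hex : ∃ n : ℕ, (2⁻¹ : ℝ) ^ n ≤ t := by
    obtain ⟨n, hn⟩ := exists_pow_lt_of_lt_one ht (by norm_num : (2⁻¹ : ℝ) < 1)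
    exact ⟨n, hn.le⟩
  have hspec := Nat.find_spec hex
  have hgt : k < Nat.find hex := by
    by_contra hcon
    have : (2⁻¹ : ℝ) ^ k ≤ (2⁻¹ : ℝ) ^ (Nat.find hex) :=
      pow_le_pow_of_le_one (by norm_num) (by norm_num) (not_lt.1 hcon)
    linarith
  refine ⟨Nat.find hex - 1 - k, ?_, ?_⟩
  · rwa [show Nat.find hex - 1 - k + k + 1 = Nat.find hex by omega]
  · rw [show Nat.find hex - 1 - k + k = Nat.find hex - 1 by omega]
    exact not_le.1 (Nat.find_min hex (by omega))

lemma upper {m : ℕ} {s : ℝ} (hs : (m : ℝ) < s) (μ : Measure (Fin (m+1) → ℝ))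
    [IsProbabilityMeasure μ] {C : ℝ≥0∞} (hC : C ≠ ∞)
    (hball : ∀ x (k : ℕ), μ (Metric.ball x ((2⁻¹ : ℝ) ^ k)) ≤ C * ((2⁻¹ : ℝ≥0∞) ^ k) ^ s)
    {R : ℝ} (hR : 0 ≤ R) :
    ∃ D q : ℝ≥0∞, D ≠ ∞ ∧ q < 1 ∧ ∀ j k : ℕ,
      ∫⁻ u in Metric.closedBall (0 : Fin m → ℝ) R, (μ.prod μ) (Prod.mk u ⁻¹' SS j k) ≤
        ((2⁻¹ : ℝ≥0∞) ^ j) ^ m * (D * q ^ k) := by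
  have hs0 : 0 < s := (Nat.cast_nonneg m).trans_lt hs
  let q : ℝ≥0∞ := 2 ^ m * (2⁻¹ : ℝ≥0∞) ^ s
  have hq : q < 1 := by
    simp only [q]
    rw [← ENNReal.rpow_natCast, ENNReal.inv_rpow, ← div_eq_mul_inv]
    rw [ENNReal.div_lt_iff (Or.inl (by simp)) (Or.inl (by simp)), one_mul]
    exact ENNReal.rpow_lt_rpow_of_exponent_lt (by norm_num) (by simp) hs
  let c : ℝ≥0∞ := ENNReal.ofReal ((8 * (R + 1)) ^ m)
  refine ⟨c * C * (1 - q)⁻¹, q, ?_, hq, ?_⟩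
  · refine ENNReal.mul_ne_top (ENNReal.mul_ne_top ENNReal.ofReal_ne_top hC) ?_
    rw [ENNReal.inv_ne_top]
    exact (tsub_pos_of_lt hq).ne'
  intro j k
  let e : ℝ≥0∞ := ((2⁻¹ : ℝ≥0∞) ^ j) ^ m
  let B : Measure (Fin m → ℝ) := volume.restrict (Metric.closedBall 0 R)
  have hswap : ∫⁻ u, (μ.prod μ) (Prod.mk u ⁻¹' SS j k) ∂B =
      ∫⁻ p, B ((fun u => (u, p)) ⁻¹' SS j k) ∂(μ.prod μ) := by
    rw [← Measure.prod_apply (measurableSet_SS j k), Measure.prod_apply_symm (measurableSet_SS j k)]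
  change ∫⁻ u, (μ.prod μ) (Prod.mk u ⁻¹' SS j k) ∂B ≤ _
  rw [hswap]
  let An : ℕ → Set ((Fin (m+1) → ℝ) × (Fin (m+1) → ℝ)) := fun i =>
    {p | dist p.1 p.2 < (2⁻¹ : ℝ) ^ i}
  have hAn : ∀ i, MeasurableSet (An i) := fun i =>
    (isOpen_lt (by fun_prop) continuous_const).measurableSet
  have hAnμ : ∀ i, (μ.prod μ) (An i) ≤ C * ((2⁻¹ : ℝ≥0∞) ^ i) ^ s := by
    intro i
    rw [Measure.prod_apply (hAn i)]
    calc ∫⁻ x, μ (Prod.mk x ⁻¹' An i) ∂μ ≤ ∫⁻ _, C * ((2⁻¹ : ℝ≥0∞) ^ i) ^ s ∂μ := by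
          refine lintegral_mono fun x => le_trans (measure_mono fun y hy => ?_) (hball x i)
          have : dist x y < (2⁻¹ : ℝ) ^ i := hy
          rwa [Metric.mem_ball, dist_comm]
      _ = _ := by simp
  have hdiag : ∀ᵐ p ∂(μ.prod μ), p.1 ≠ p.2 := by
    have h0 : ∀ x, μ {x} = 0 := by
      intro x
      have hle : ∀ i : ℕ, μ {x} ≤ C * ((2⁻¹ : ℝ≥0∞) ^ i) ^ s := fun i =>
        (measure_mono (by simp)).trans (hball x i)
      have ht : Tendsto (fun j : ℕ => (2⁻¹ : ℝ≥0∞) ^ j) atTop (𝓝 0) :=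
        ENNReal.tendsto_pow_atTop_nhds_zero_of_lt_one (by simp)
      have ht2 : Tendsto (fun j : ℕ => ((2⁻¹ : ℝ≥0∞) ^ j) ^ s) atTop (𝓝 0) := by
        have := (ENNReal.continuous_rpow_const (y := s)).tendsto 0 |>.comp ht
        simpa [Function.comp_def, ENNReal.zero_rpow_of_pos hs0] using this
      have ht3 := ENNReal.Tendsto.const_mul ht2 (Or.inr hC)
      rw [mul_zero] at ht3
      exact le_antisymm (ge_of_tendsto' ht3 hle) bot_le
    have hm : MeasurableSet {p : (Fin (m+1) → ℝ) × (Fin (m+1) → ℝ) | p.1 = p.2} :=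
      measurableSet_eq_fun measurable_fst measurable_snd
    have hz : (μ.prod μ) {p : (Fin (m+1) → ℝ) × (Fin (m+1) → ℝ) | p.1 = p.2} = 0 := by
      rw [Measure.prod_apply hm]
      refine (lintegral_congr fun x => ?_).trans lintegral_zero
      convert h0 x using 2
      ext y; simp [eq_comm]
    rw [ae_iff]
    simpa using hz
  have hbound : ∀ᵐ p ∂(μ.prod μ), B ((fun u => (u, p)) ⁻¹' SS j k) ≤
      ∑' i : ℕ, (An (i + k)).indicator (fun _ => c * e * (2 ^ m) ^ (i + k)) p := by
    filter_upwards [hdiag] with p hp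
    by_cases hpk : dist p.1 p.2 < (2⁻¹ : ℝ) ^ k
    · obtain ⟨i, hi1, hi2⟩ := exists_scale (dist_pos.2 hp) hpk
      refine le_trans ?_ (ENNReal.le_tsum i)
      rw [indicator_of_mem (by exact hi2)]
      have hmeas : MeasurableSet ((fun u => (u, p)) ⁻¹' SS (m := m) j k) :=
        (measurable_id.prodMk measurable_const) (measurableSet_SS j k)
      simp only [B]
      rw [Measure.restrict_apply hmeas]
      refine (measure_mono (inter_subset_inter_left _ ?_)).trans
        ((vol_le hR hp (δ := (2⁻¹ : ℝ) ^ j) (by positivity)).trans ?_)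
      · intro u hu; exact hu.1
      · have h1 : c * e * (2 ^ m) ^ (i + k) =
            ENNReal.ofReal ((8 * (R + 1) * 2⁻¹ ^ j * 2 ^ (i + k)) ^ m) := by
          have e1 : e = ENNReal.ofReal (((2⁻¹ : ℝ) ^ j) ^ m) := by
            rw [ENNReal.ofReal_pow (by positivity), ENNReal.ofReal_pow (by positivity),
              ENNReal.ofReal_inv_of_pos (by norm_num)]
            simp [e]
          have e2 : ((2 : ℝ≥0∞) ^ m) ^ (i + k) = ENNReal.ofReal (((2 : ℝ) ^ m) ^ (i + k)) := by
            rw [ENNReal.ofReal_pow (by positivity), ENNReal.ofReal_pow (by positivity)]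
            simp
          rw [e1, e2, ← ENNReal.ofReal_mul (by positivity), ← ENNReal.ofReal_mul (by positivity)]
          congr 1
          simp only [mul_pow, ← pow_mul, mul_comm m]
        rw [h1]
        refine ENNReal.ofReal_le_ofReal (pow_le_pow_left₀ (by positivity) ?_ m)
        rw [div_le_iff₀ (dist_pos.2 hp)]
        have h3 : (1:ℝ) ≤ 2 * 2 ^ (i + k) * dist p.1 p.2 := by
          rw [inv_pow, inv_le_iff_one_le_mul₀ (by positivity), pow_succ] at hi1
          linarith
        have h4 : 0 ≤ 4 * (R + 1) * (2⁻¹ : ℝ) ^ j := by positivity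
        nlinarith
    · have : (fun u => (u, p)) ⁻¹' SS (m := m) j k = ∅ := by
        ext u; simp only [SS, mem_preimage, mem_ofPred_eq, mem_empty_iff_false, iff_false]
        exact fun h => hpk h.2
      rw [this]; simp
  calc ∫⁻ p, B ((fun u => (u, p)) ⁻¹' SS j k) ∂(μ.prod μ)
      ≤ ∫⁻ p, ∑' i : ℕ, (An (i + k)).indicator (fun _ => c * e * (2 ^ m) ^ (i + k)) p
          ∂(μ.prod μ) := lintegral_mono_ae hbound
    _ = ∑' i : ℕ, ∫⁻ p, (An (i + k)).indicator (fun _ => c * e * (2 ^ m) ^ (i + k)) p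
          ∂(μ.prod μ) := lintegral_tsum fun i =>
            (measurable_const.indicator (hAn _)).aemeasurable
    _ = ∑' i : ℕ, c * e * (2 ^ m) ^ (i + k) * (μ.prod μ) (An (i + k)) := by
        refine tsum_congr fun i => ?_
        rw [lintegral_indicator_const (hAn _)]
    _ ≤ ∑' i : ℕ, e * (c * C * q ^ k) * q ^ i := by
        refine ENNReal.tsum_le_tsum fun i => ?_
        refine (mul_le_mul_right (hAnμ (i + k)) _).trans (le_of_eq ?_)
        have hr : ((2⁻¹ : ℝ≥0∞) ^ (i + k)) ^ s = ((2⁻¹ : ℝ≥0∞) ^ s) ^ (i + k) := by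
          rw [← ENNReal.rpow_natCast, ← ENNReal.rpow_mul, mul_comm, ENNReal.rpow_mul,
            ENNReal.rpow_natCast]
        have hqq : q ^ k * q ^ i = (2 ^ m) ^ (i + k) * ((2⁻¹ : ℝ≥0∞) ^ s) ^ (i + k) := by
          rw [← pow_add, add_comm k i, ← mul_pow]
        calc _ = e * (c * C) * ((2 ^ m) ^ (i + k) * ((2⁻¹ : ℝ≥0∞) ^ s) ^ (i + k)) := by
              rw [hr]; ring
          _ = _ := by rw [← hqq]; ring
    _ = _ := by
        rw [ENNReal.tsum_mul_left, ENNReal.tsum_geometric]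
        simp only [e]
        ring


lemma main_coord {m : ℕ} {Et : Set (Fin (m+1) → ℝ)} (hEt : MeasurableSet Et) (u0 : Fin m → ℝ)
    {ρ : ℝ} (hρ : 0 < ρ)
    (hc : ∀ u ∈ Metric.ball u0 ρ, ∀ a, (Et ∩ pr u ⁻¹' {a}).Countable) : dimH Et ≤ m := by
  by_contra hcon
  obtain ⟨s, hs1, hs2⟩ := ENNReal.lt_iff_exists_nnreal_btwn.1 (not_le.1 hcon)
  have hms : (m : ℝ) < (s : ℝ) := by exact_mod_cast hs1
  have hs0 : 0 < (s : ℝ) := (Nat.cast_nonneg m).trans_lt hms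
  have hH : μH[(s : ℝ)] Et ≠ 0 := by
    rw [hausdorffMeasure_of_lt_dimH hs2]; simp
  obtain ⟨K, hKE, hK, μ, hμ, hμK, C, hC, hball⟩ := frostman hs0 hEt hH
  let R : ℝ := ‖u0‖ + ρ
  have hR : 0 ≤ R := by positivity
  have hBR : Metric.ball u0 ρ ⊆ Metric.closedBall 0 R := by
    intro u hu
    rw [Metric.mem_ball] at hu
    rw [Metric.mem_closedBall]
    calc dist u 0 ≤ dist u u0 + dist u0 0 := dist_triangle _ _ _
      _ ≤ R := by simp only [R, dist_zero_right]; linarith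
  obtain ⟨D, q, hD, hq, hup⟩ := upper hms μ hC hball hR
  let F : ℕ → ℕ → (Fin m → ℝ) → ℝ≥0∞ := fun k j u =>
    ((2 : ℝ≥0∞) ^ j) ^ m * (μ.prod μ) (Prod.mk u ⁻¹' SS j k)
  have hF : ∀ k j, Measurable (F k j) := fun k j =>
    (measurable_measure_prodMk_left (measurableSet_SS j k)).const_mul _
  let H : ℕ → (Fin m → ℝ) → ℝ≥0∞ := fun k u => liminf (fun j => F k j u) atTop
  have hHm : ∀ k, Measurable (H k) := fun k => Measurable.liminf (hF k)
  let B : Measure (Fin m → ℝ) := volume.restrict (Metric.closedBall 0 R)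
  have hFB : ∀ k j, ∫⁻ u, F k j u ∂B ≤ D * q ^ k := by
    intro k j
    simp only [F]
    rw [lintegral_const_mul _ (measurable_measure_prodMk_left (measurableSet_SS j k))]
    refine (mul_le_mul_right (hup j k) _).trans (le_of_eq ?_)
    rw [← mul_assoc, ← mul_pow, ← mul_pow, ENNReal.mul_inv_cancel (by simp) (by simp)]
    simp
  have hHB : ∀ k, ∫⁻ u, H k u ∂B ≤ D * q ^ k := by
    intro k
    refine (lintegral_liminf_le (hF k)).trans ?_
    calc liminf (fun j => ∫⁻ u, F k j u ∂B) atTop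
        ≤ liminf (fun _ : ℕ => D * q ^ k) atTop := liminf_le_liminf (Eventually.of_forall (hFB k))
      _ = _ := liminf_const _
  have hzero : ∫⁻ u, (⨅ k, H k u) ∂B = 0 := by
    have ht : Tendsto (fun k : ℕ => D * q ^ k) atTop (𝓝 0) := by
      have := ENNReal.Tendsto.const_mul
        (ENNReal.tendsto_pow_atTop_nhds_zero_of_lt_one hq) (Or.inr hD)
      rwa [mul_zero] at this
    refine le_antisymm (ge_of_tendsto' ht fun k => ?_) bot_le
    exact (lintegral_mono fun u => iInf_le _ k).trans (hHB k)
  rw [lintegral_eq_zero_iff (Measurable.iInf hHm)] at hzero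
  have hpos : ∀ u ∈ Metric.ball u0 ρ, (⨅ k, H k u) ≠ 0 := by
    intro u hu
    have hπ : Continuous (pr u) := continuous_pr.comp (by fun_prop :
      Continuous fun x : Fin (m+1) → ℝ => (u, x))
    obtain ⟨A, hAK, hA, hμA, hinj⟩ := exists_inj μ hK hμK (pr u) hπ
      (fun a => (hc u hu a).mono (inter_subset_inter_left _ hKE))
    obtain ⟨L, hL⟩ : ∃ L : ℕ, ∀ x ∈ A, ∀ i, |pr u x i| ≤ L := by
      obtain ⟨b, hb⟩ := (hA.image hπ).isBounded.exists_norm_le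
      obtain ⟨L, hL⟩ := exists_nat_ge b
      refine ⟨L, fun x hx i => ?_⟩
      exact (norm_le_pi_norm (pr u x) i).trans ((hb _ ⟨x, hx, rfl⟩).trans hL)
    have key : ∀ k, μ A ^ 2 / ((2 * L + 1 : ℕ) : ℝ≥0∞) ^ m ≤ H k u := by
      intro k
      obtain ⟨δ, hδ, hδA⟩ := unif hA (pr u) hπ hinj (r := (2⁻¹ : ℝ) ^ k) (by positivity)
      obtain ⟨N, hN⟩ := exists_pow_lt_of_lt_one hδ (by norm_num : (2⁻¹ : ℝ) < 1)
      refine le_liminf_of_le (by isBoundedDefault) ?_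
      filter_upwards [eventually_ge_atTop N] with j hj
      have hjδ : (2⁻¹ : ℝ) ^ j < δ :=
        (pow_le_pow_of_le_one (by norm_num) (by norm_num) hj).trans_lt hN
      have hp := pigeon μ hA.measurableSet (pr u) hπ.measurable L hL j (Prod.mk u ⁻¹' SS j k)
        (fun x hx y hy hxy => ⟨hxy, hδA x hx y hy (hxy.trans_lt hjδ)⟩)
      refine ENNReal.div_le_of_le_mul ?_
      simp only [F]
      refine hp.trans (le_of_eq ?_)
      ring
    have hcpos : μ A ^ 2 / ((2 * L + 1 : ℕ) : ℝ≥0∞) ^ m ≠ 0 := by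
      refine ENNReal.div_ne_zero.2 ⟨pow_ne_zero _ hμA, ?_⟩
      exact ENNReal.pow_ne_top (ENNReal.natCast_ne_top _)
    intro h
    have := le_iInf key
    rw [h] at this
    exact hcpos (le_antisymm this bot_le)
  have hb0 : volume (Metric.ball u0 ρ) = 0 := by
    have h1 : B (Metric.ball u0 ρ) = 0 := by
      refine measure_mono_null (fun u hu => ?_) (ae_iff.1 hzero)
      exact hpos u hu
    simp only [B] at h1
    rwa [Measure.restrict_apply measurableSet_ball, inter_eq_left.2 hBR] at h1
  exact (Metric.measure_ball_pos volume u0 hρ).ne' hb0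

end Slice

/-- If `E ⊆ ℝⁿ` is contained in a Borel set `Ẽ` such that for a nonempty open set of
directions every line through a point of `Ẽ` with such a direction meets `Ẽ` in an at most
countable set, then the Hausdorff dimension of `E` is at most `n - 1`. -/
theorem stmt4 (n : ℕ) (E Et : Set (EuclideanSpace ℝ (Fin n)))
    (hEEt : E ⊆ Et) (hBorel : MeasurableSet Et)
    (U : Set (EuclideanSpace ℝ (Fin n))) (hUopen : IsOpen U) (hUne : U.Nonempty)
    (hU0 : (0 : EuclideanSpace ℝ (Fin n)) ∉ U)
    (hlines : ∀ x ∈ Et, ∀ v ∈ U, {t : ℝ | x + t • v ∈ Et}.Countable) :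
    dimH E ≤ (n : ℝ≥0∞) - 1 := by
  refine (dimH_mono hEEt).trans ?_
  rcases n with _ | m
  · obtain ⟨v, hv⟩ := hUne
    exact absurd (Subsingleton.elim v 0 ▸ hv) hU0
  have hn : ((m + 1 : ℕ) : ℝ≥0∞) - 1 = m := by
    push_cast
    exact ENNReal.add_sub_cancel_right (by simp)
  rw [hn]
  let φ : EuclideanSpace ℝ (Fin (m+1)) ≃L[ℝ] (Fin (m+1) → ℝ) := EuclideanSpace.equiv (Fin (m+1)) ℝ
  rw [← φ.dimH_image Et, φ.image_eq_preimage_symm]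
  have hU' : IsOpen (φ.symm ⁻¹' U) := hUopen.preimage φ.symm.continuous
  have hne : ∃ c : ℝ, c ≠ 0 ∧ ∃ w : Fin m → ℝ, (Fin.cons c w : Fin (m+1) → ℝ) ∈ φ.symm ⁻¹' U := by
    obtain ⟨v, hv⟩ := hUne
    let w : Fin m → ℝ := fun i => φ v i.succ
    have hcont : Continuous fun t : ℝ => (Fin.cons t w : Fin (m+1) → ℝ) := by fun_prop
    have ho : IsOpen ((fun t : ℝ => (Fin.cons t w : Fin (m+1) → ℝ)) ⁻¹' (φ.symm ⁻¹' U)) :=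
      hU'.preimage hcont
    have hmem : (Fin.cons (φ v 0) w : Fin (m+1) → ℝ) ∈ φ.symm ⁻¹' U := by
      have : (Fin.cons (φ v 0) w : Fin (m+1) → ℝ) = φ v := Fin.cons_self_tail (φ v)
      rw [this]; simpa using hv
    obtain ⟨c, hc1, hc2⟩ := (dense_compl_singleton (0 : ℝ)).inter_open_nonempty _ ho ⟨_, hmem⟩
    exact ⟨c, hc2, w, hc1⟩
  obtain ⟨c, hc, w, hw⟩ := hne
  have hcont : Continuous fun u : Fin m → ℝ => (Fin.cons c (c • u) : Fin (m+1) → ℝ) := by fun_prop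
  have ho := hU'.preimage hcont
  obtain ⟨ρ, hρ, hball⟩ := Metric.isOpen_iff.1 ho (c⁻¹ • w) (by
    change (Fin.cons c (c • c⁻¹ • w) : Fin (m+1) → ℝ) ∈ φ.symm ⁻¹' U
    rwa [smul_inv_smul₀ hc])
  refine Slice.main_coord (φ.symm.continuous.measurable hBorel) (c⁻¹ • w) hρ ?_
  intro u hu a
  rcases (φ.symm ⁻¹' Et ∩ Slice.pr u ⁻¹' {a}).eq_empty_or_nonempty with h | ⟨x, hxE, hxa⟩
  · rw [h]; exact Set.countable_empty
  have hvU := hball hu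
  let z : Fin (m+1) → ℝ := Fin.cons c (c • u)
  have hcnt := hlines (φ.symm x) hxE (φ.symm z) hvU
  refine (hcnt.image fun t : ℝ => x + t • z).mono ?_
  rintro y ⟨hyE, hya⟩
  have hy : x + ((y 0 - x 0) / c) • z = y := by
    ext i
    refine Fin.cases ?_ (fun i => ?_) i
    · simp only [z, Pi.add_apply, Pi.smul_apply, Fin.cons_zero, smul_eq_mul]
      field_simp; ring
    · have h1 : Slice.pr u y i = Slice.pr u x i := by
        rw [show Slice.pr u y = a from hya, show Slice.pr u x = a from hxa]
      simp only [Slice.pr] at h1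
      simp only [z, Pi.add_apply, Pi.smul_apply, Fin.cons_succ, smul_eq_mul]
      field_simp
      linarith
  refine ⟨(y 0 - x 0) / c, ?_, hy⟩
  change φ.symm x + ((y 0 - x 0) / c) • φ.symm z ∈ Et
  rw [← map_smul, ← map_add, hy]
  exact hyE
end

section
/- Let C ⊂ ℝ^n be a nonempty open cone of directions and let Ẽ ⊆ ℝ^n be a Borel set such that for every x ∈ ℝ^n and every direction v ∈ C, the set {t ∈ ℝ : x + tv ∈ Ẽ} is at most countable. Then the Hausdorff dimension of Ẽ is at most n − 1. -/
open scoped ENNReal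

namespace FrostAux

open scoped ENNReal NNReal Topology
open MeasureTheory Set Filter

noncomputable def cost {β : Type*} (w : ℕ → ℝ≥0∞) (W : Set (ℕ × β)) : ℝ≥0∞ :=
  ∑' p, W.indicator (fun p => w p.1) p

def Cov {T β : Type*} (q : ℕ → T → β) (W : Set (ℕ × β)) (A : Set T) : Prop :=
  ∀ x ∈ A, ∃ k, (k, q k x) ∈ W

noncomputable def cont {T β : Type*} (q : ℕ → T → β) (w : ℕ → ℝ≥0∞) (A : Set T) : ℝ≥0∞ :=
  ⨅ (W : Set (ℕ × β)) (_ : Cov q W A), cost w W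

def mU {β : Type*} (par : β → β) (V W : Set (ℕ × β)) : Set (ℕ × β) :=
  {p | p ∈ V ∪ W ∧ ∀ l < p.1, (l, par^[p.1 - l] p.2) ∉ V ∪ W}

def mI {β : Type*} (par : β → β) (V W : Set (ℕ × β)) : Set (ℕ × β) :=
  {p | p ∈ V ∪ W ∧ (∃ l ≤ p.1, (l, par^[p.1 - l] p.2) ∈ V) ∧
    (∃ l ≤ p.1, (l, par^[p.1 - l] p.2) ∈ W)}

section
variable {T β : Type*} {par : β → β} {q : ℕ → T → β} {w : ℕ → ℝ≥0∞}

lemma cont_le {W : Set (ℕ × β)} {A : Set T} (h : Cov q W A) : cont q w A ≤ cost w W :=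
  iInf₂_le W h

lemma exists_cov {A : Set T} {c : ℝ≥0∞} (h : cont q w A < c) :
    ∃ W, Cov q W A ∧ cost w W < c := by
  unfold cont at h
  simp only [iInf_lt_iff] at h
  obtain ⟨W, hW, h⟩ := h
  exact ⟨W, hW, h⟩

lemma cont_mono {A B : Set T} (h : A ⊆ B) : cont q w A ≤ cont q w B :=
  le_iInf₂ fun _ hW => cont_le fun x hx => hW x (h hx)

lemma cont_iUnion {ι : Type*} [Countable ι] (A : ι → Set T) :
    cont q w (⋃ i, A i) ≤ ∑' i, cont q w (A i) := by
  refine ENNReal.le_of_forall_pos_le_add fun ε hε hfin => ?_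
  obtain ⟨ε', hε', hsum⟩ := ENNReal.exists_pos_sum_of_countable
    (ENNReal.coe_pos.2 hε).ne' ι
  have : ∀ i, ∃ W, Cov q W (A i) ∧ cost w W < cont q w (A i) + ε' i := fun i =>
    exists_cov (ENNReal.lt_add_right (ENNReal.ne_top_of_tsum_ne_top hfin.ne i)
      (ENNReal.coe_pos.2 (hε' i)).ne')
  choose W hW hc using this
  have h1 : Cov q (⋃ i, W i) (⋃ i, A i) := by
    intro x hx
    obtain ⟨i, hi⟩ := mem_iUnion.1 hx
    obtain ⟨k, hk⟩ := hW i x hi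
    exact ⟨k, mem_iUnion.2 ⟨i, hk⟩⟩
  calc cont q w (⋃ i, A i) ≤ cost w (⋃ i, W i) := cont_le h1
    _ ≤ ∑' i, cost w (W i) := by
      unfold cost
      rw [ENNReal.tsum_comm]
      refine ENNReal.tsum_le_tsum fun p => ?_
      by_cases hp : p ∈ ⋃ i, W i
      · obtain ⟨i, hi⟩ := mem_iUnion.1 hp
        rw [indicator_of_mem hp]
        refine le_trans ?_ (ENNReal.le_tsum i)
        rw [indicator_of_mem hi]
      · rw [indicator_of_notMem hp]; exact zero_le
    _ ≤ ∑' i, (cont q w (A i) + ε' i) := ENNReal.tsum_le_tsum fun i => (hc i).le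
    _ ≤ _ := by
      rw [ENNReal.tsum_add]
      gcongr

lemma anc (hpar : ∀ k x, q k x = par (q (k + 1) x)) (x : T) (l d : ℕ) :
    par^[d] (q (l + d) x) = q l x := by
  induction d with
  | zero => rfl
  | succ d ih => rw [Function.iterate_succ_apply, ← add_assoc, ← hpar, ih]

lemma anc' (hpar : ∀ k x, q k x = par (q (k + 1) x)) (x : T) {l k : ℕ} (h : l ≤ k) :
    par^[k - l] (q k x) = q l x := by
  obtain ⟨d, rfl⟩ := Nat.exists_eq_add_of_le h
  rw [Nat.add_sub_cancel_left]; exact anc hpar x l d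

lemma cost_merge (V W : Set (ℕ × β)) :
    cost w (mU par V W) + cost w (mI par V W) ≤ cost w V + cost w W := by
  unfold cost
  rw [← ENNReal.tsum_add, ← ENNReal.tsum_add]
  refine ENNReal.tsum_le_tsum fun p => ?_
  by_cases hV : p ∈ V <;> by_cases hW : p ∈ W
  · rw [indicator_of_mem hV, indicator_of_mem hW]
    exact add_le_add (indicator_le_self _ _ _) (indicator_le_self _ _ _)
  · rw [indicator_of_mem hV, indicator_of_notMem hW]
    by_cases hI : p ∈ mI par V W
    · have : p ∉ mU par V W := by
        rintro ⟨-, h2⟩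
        obtain ⟨-, -, l, hl, h3⟩ := hI
        rcases hl.lt_or_eq with h | h
        · exact h2 l h (Or.inr h3)
        · subst h; simp at h3; exact hW h3
      rw [indicator_of_notMem this, indicator_of_mem hI, add_comm]
    · rw [indicator_of_notMem hI]; gcongr; exact indicator_le_self _ _ _
  · rw [indicator_of_mem hW, indicator_of_notMem hV]
    by_cases hI : p ∈ mI par V W
    · have : p ∉ mU par V W := by
        rintro ⟨-, h2⟩
        obtain ⟨-, ⟨l, hl, h3⟩, -⟩ := hI
        rcases hl.lt_or_eq with h | h
        · exact h2 l h (Or.inl h3)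
        · subst h; simp at h3; exact hV h3
      rw [indicator_of_notMem this, indicator_of_mem hI]
    · rw [indicator_of_notMem hI, add_comm]; gcongr; exact indicator_le_self _ _ _
  · have h1 : p ∉ mU par V W := fun h => h.1.elim hV hW
    have h2 : p ∉ mI par V W := fun h => h.1.elim hV hW
    rw [indicator_of_notMem h1, indicator_of_notMem h2]; simp

/-- some element at or above any element of V ∪ W -/
lemma mem_mU (hpar : ∀ k x, q k x = par (q (k + 1) x)) {V W : Set (ℕ × β)} {x : T} {k : ℕ}
    (h : (k, q k x) ∈ V ∪ W) : ∃ l ≤ k, (l, q l x) ∈ mU par V W := by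
  classical
  have hex : ∃ k, (k, q k x) ∈ V ∪ W := ⟨k, h⟩
  refine ⟨Nat.find hex, Nat.find_min' hex h, Nat.find_spec hex, fun l hl => ?_⟩
  simp only at hl ⊢
  rw [anc' hpar x hl.le]
  exact Nat.find_min hex hl

lemma cov_mI (hpar : ∀ k x, q k x = par (q (k + 1) x)) {V W : Set (ℕ × β)} {A : Set T}
    (hV : Cov q V A) (hW : Cov q W A) : Cov q (mI par V W) A := by
  intro x hx
  obtain ⟨k, hk⟩ := hV x hx
  obtain ⟨l, hl⟩ := hW x hx
  rcases le_total k l with h | h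
  · refine ⟨l, Or.inr hl, ⟨k, h, ?_⟩, ⟨l, le_rfl, ?_⟩⟩
    · simp only; rw [anc' hpar x h]; exact hk
    · simpa using hl
  · refine ⟨k, Or.inl hk, ⟨k, le_rfl, ?_⟩, ⟨l, h, ?_⟩⟩
    · simpa using hk
    · simp only; rw [anc' hpar x h]; exact hl

def vseq (par : β → β) (W : ℕ → Set (ℕ × β)) : ℕ → Set (ℕ × β)
  | 0 => W 0
  | k + 1 => mU par (vseq par W k) (W (k + 1))

theorem cont_iUnion_mono (hpar : ∀ k x, q k x = par (q (k + 1) x)) {A : ℕ → Set T}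
    (hA : Monotone A) {c : ℝ≥0∞} (hc : c ≠ ∞) (h : ∀ k, cont q w (A k) ≤ c) :
    cont q w (⋃ k, A k) ≤ c := by
  refine ENNReal.le_of_forall_pos_le_add fun ε hε _ => ?_
  obtain ⟨ε', hε', hsum⟩ := ENNReal.exists_pos_sum_of_countable
    (ENNReal.coe_pos.2 hε).ne' ℕ
  have hf : ∀ k, cont q w (A k) ≠ ∞ := fun k => ne_top_of_le_ne_top hc (h k)
  have : ∀ i, ∃ W, Cov q W (A i) ∧ cost w W < cont q w (A i) + ε' i := fun i =>
    exists_cov (ENNReal.lt_add_right (hf i) (ENNReal.coe_pos.2 (hε' i)).ne')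
  choose W hW hcW using this
  have hcov : ∀ k, Cov q (vseq par W k) (A k) := by
    intro k
    cases k with
    | zero => exact hW 0
    | succ k =>
      intro x hx
      obtain ⟨l, hl⟩ := hW (k + 1) x hx
      obtain ⟨l', -, h'⟩ := mem_mU hpar (V := vseq par W k) (Or.inr hl)
      exact ⟨l', h'⟩
  have hcost : ∀ k, cost w (vseq par W k) ≤
      cont q w (A k) + ∑ i ∈ Finset.range (k + 1), (ε' i : ℝ≥0∞) := by
    intro k
    induction k with
    | zero => simpa [vseq] using (hcW 0).le
    | succ k ih =>
      have h1 : cost w (vseq par W (k + 1)) + cont q w (A k) ≤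
          cost w (vseq par W k) + cost w (W (k + 1)) :=
        le_trans (add_le_add le_rfl (cont_le (cov_mI hpar (hcov k)
          (fun x hx => hW (k + 1) x (hA k.le_succ hx))))) (cost_merge (par := par) _ _)
      have h2 : cost w (vseq par W (k + 1)) + cont q w (A k) ≤
        (cont q w (A (k + 1)) + ∑ i ∈ Finset.range (k + 1 + 1), (ε' i : ℝ≥0∞)) +
          cont q w (A k) := by
        refine h1.trans ((add_le_add ih (hcW (k + 1)).le).trans ?_)
        rw [Finset.sum_range_succ _ (k + 1)]
        apply le_of_eq; ring
      exact (ENNReal.add_le_add_iff_right (hf k)).1 h2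
  have hcost' : ∀ k, cost w (vseq par W k) ≤ c + ε := fun k =>
    (hcost k).trans (add_le_add (h k) ((ENNReal.sum_le_tsum _).trans hsum.le))
  let Vi : Set (ℕ × β) := {p | ∀ᶠ k in atTop, p ∈ vseq par W k}
  have hVcov : Cov q Vi (⋃ k, A k) := by
    intro x hx
    obtain ⟨j, hj⟩ := mem_iUnion.1 hx
    classical
    have hex : ∀ k, ∃ l, (l, q l x) ∈ vseq par W (j + k) := fun k =>
      hcov (j + k) x (hA (Nat.le_add_right j k) hj)
    have hanti : Antitone fun k => Nat.find (hex k) := by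
      refine antitone_nat_of_succ_le fun k => ?_
      obtain ⟨l, hl, h'⟩ := mem_mU hpar (W := W (j + k + 1)) (Or.inl (Nat.find_spec (hex k)))
      exact (Nat.find_min' (hex (k + 1)) h').trans hl
    obtain ⟨N, hN⟩ : ∃ N, ∀ k ≥ N, Nat.find (hex k) = Nat.find (hex N) := by
      obtain ⟨N, hN⟩ := WellFounded.has_min (wellFounded_lt (α := ℕ))
        (range fun k => Nat.find (hex k)) ⟨_, 0, rfl⟩
      obtain ⟨⟨N, rfl⟩, hN⟩ := hN
      exact ⟨N, fun k hk => le_antisymm (hanti hk) (not_lt.1 (hN _ ⟨k, rfl⟩))⟩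
    refine ⟨Nat.find (hex N), ?_⟩
    refine eventually_atTop.2 ⟨j + N, fun k hk => ?_⟩
    obtain ⟨d, rfl⟩ := Nat.exists_eq_add_of_le hk
    have := Nat.find_spec (hex (N + d))
    rw [hN (N + d) (Nat.le_add_right _ _), ← add_assoc] at this
    exact this
  refine (cont_le hVcov).trans ?_
  unfold cost
  rw [ENNReal.tsum_eq_iSup_sum]
  refine iSup_le fun F => ?_
  have : ∀ᶠ k in atTop, ∀ p ∈ F, p ∈ Vi → p ∈ vseq par W k := by
    rw [eventually_all_finset]
    intro p hp
    by_cases hpV : p ∈ Vi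
    · filter_upwards [hpV] with k hk _ using hk
    · exact Eventually.of_forall fun k h => absurd h hpV
  obtain ⟨k, hk⟩ := this.exists
  refine le_trans ?_ (hcost' k)
  refine le_trans (Finset.sum_le_sum fun p hp => ?_) (ENNReal.sum_le_tsum F)
  by_cases hpV : p ∈ Vi
  · rw [indicator_of_mem hpV, indicator_of_mem (hk p hp hpV)]
  · rw [indicator_of_notMem hpV]; exact zero_le

end
end FrostAux

namespace FrostAux

open scoped ENNReal NNReal Topology
open MeasureTheory Set Filter

section
variable {T β : Type*} {par : β → β} {w : ℕ → ℝ≥0∞}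

theorem exists_compact [TopologicalSpace β] [DiscreteTopology β] {q : ℕ → (ℕ → ℕ) → β}
    (hq : ∀ k, Continuous (q k)) (hpar : ∀ k x, q k x = par (q (k + 1) x))
    (h : cont q w univ ≠ 0) : ∃ L : Set (ℕ → ℕ), IsCompact L ∧ cont q w L ≠ 0 := by
  obtain ⟨c, hc0, hc⟩ := exists_between (pos_iff_ne_zero.2 h)
  have hct : c ≠ ∞ := hc.ne_top
  have key : ∀ (B : Set (ℕ → ℕ)) (_ : c < cont q w B) (k : ℕ),
      ∃ N : ℕ, c < cont q w (B ∩ {x | x k ≤ N}) := by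
    intro B hB k
    by_contra! hcon
    have := cont_iUnion_mono hpar (A := fun N => B ∩ {x | x k ≤ N})
      (fun a b hab x hx => ⟨hx.1, le_trans hx.2 hab⟩) hct hcon
    rw [← inter_iUnion] at this
    have hu : (⋃ N : ℕ, {x : ℕ → ℕ | x k ≤ N}) = univ :=
      eq_univ_of_forall fun x => mem_iUnion.2 ⟨x k, le_refl (x k)⟩
    rw [hu, inter_univ] at this
    exact absurd hB (not_lt.2 this)
  choose N hN using key
  let S : ℕ → {B : Set (ℕ → ℕ) // c < cont q w B} := fun k => Nat.rec ⟨univ, hc⟩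
    (fun k B => ⟨B.1 ∩ {x | x k ≤ N B.1 B.2 k}, hN B.1 B.2 k⟩) k
  let n : ℕ → ℕ := fun k => N (S k).1 (S k).2 k
  have hS : ∀ k x, x ∈ (S k).1 ↔ ∀ i < k, x i ≤ n i := by
    intro k x
    induction k with
    | zero => simp [S]
    | succ k ih =>
      have : x ∈ (S (k + 1)).1 ↔ x ∈ (S k).1 ∧ x k ≤ n k := Iff.rfl
      rw [this, ih, Nat.forall_lt_succ_right]
  refine ⟨univ.pi fun i => Iic (n i), isCompact_univ_pi fun i => (finite_Iic (n i)).isCompact,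
    ?_⟩
  refine ne_of_gt (lt_of_lt_of_le hc0 (le_iInf₂ fun W hW => ?_))
  by_contra! hlt
  have : ∃ k, Cov q W (S k).1 := by
    by_contra! hcon
    simp only [Cov] at hcon
    push Not at hcon
    choose x hx hxW using hcon
    obtain ⟨y, hy, φ, hφ, hlim⟩ := (isCompact_univ_pi fun i =>
      (finite_Iic (n i)).isCompact).tendsto_subseq (x := fun k i => min (x k i) (n i))
      (fun k i _ => mem_Iic.2 (min_le_right (x k i) (n i)))
    have hlim' : Tendsto (x ∘ φ) atTop (𝓝 y) := by
      rw [tendsto_pi_nhds] at hlim ⊢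
      intro i
      refine (hlim i).congr' ?_
      filter_upwards [eventually_gt_atTop i] with j hj
      exact min_eq_left (((hS _ _).1 (hx (φ j))) i (hj.trans_le (hφ.id_le j)))
    obtain ⟨l, hl⟩ := hW y hy
    have h1 := ((hq l).tendsto y).comp hlim'
    rw [nhds_discrete, tendsto_pure] at h1
    obtain ⟨j, hj⟩ := h1.exists
    apply hxW (φ j) l
    simp only [Function.comp] at hj
    rw [hj]; exact hl
  obtain ⟨k, hk⟩ := this
  exact absurd ((S k).2.trans_le (cont_le hk)) (not_lt.2 hlt.le)

lemma cont_cell_le {q : ℕ → T → β} (k : ℕ) (b : β) : cont q w {x | q k x = b} ≤ w k := by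
  refine (cont_le (W := {(k, b)}) ?_).trans ?_
  · intro x hx
    exact ⟨k, by rw [mem_singleton_iff]; exact congrArg _ hx⟩
  · unfold cost
    rw [tsum_eq_single (k, b)]
    · simp
    · intro p hp
      exact indicator_of_notMem (by simpa using hp) _

theorem exists_level [MeasurableSpace T] {q : ℕ → T → β}
    (hpar : ∀ k x, q k x = par (q (k + 1) x))
    (hm : ∀ k b, MeasurableSet {x | q k x = b})
    (hfin : ∀ k, (range (q k)).Finite) (hw : ∀ k, w k ≠ ∞) (d : ℕ) : ∀ (k : ℕ) (b : β),
    ∃ ν : Measure T, ν univ = cont q w {x | q k x = b} ∧ ν {x | q k x ≠ b} = 0 ∧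
      ∀ l, k ≤ l → l ≤ k + d → ∀ b', ν {x | q l x = b'} ≤ w l := by
  classical
  induction d with
  | zero =>
    intro k b
    rcases eq_empty_or_nonempty {x | q k x = b} with h | ⟨x, hx⟩
    · refine ⟨0, ?_, by simp, by simp⟩
      rw [h]
      refine le_antisymm (zero_le) ((cont_le (W := ∅) (fun x hx => hx.elim)).trans ?_)
      simp [cost]
    · refine ⟨cont q w {x | q k x = b} • Measure.dirac x, by simp, ?_, ?_⟩
      · rw [Measure.smul_apply]
        change _ • (Measure.dirac x) {x | q k x = b}ᶜ = 0
        rw [Measure.dirac_apply' x (hm k b).compl,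
          indicator_of_notMem (show x ∉ {x | q k x = b}ᶜ from fun hn => hn hx), smul_zero]
      · intro l hl hl' b'
        obtain rfl : l = k := by omega
        refine (measure_mono (subset_univ _)).trans ?_
        simpa using cont_cell_le l b
  | succ d ih =>
    intro k b
    choose ν h1 h2 h3 using ih (k + 1)
    let R : Finset β := (hfin (k + 1)).toFinset.filter (fun b'' => par b'' = b)
    have hR : ∀ x, q k x = b → q (k + 1) x ∈ R := by
      intro x hx
      simp only [R, Finset.mem_filter, Finite.mem_toFinset]
      exact ⟨⟨x, rfl⟩, by rw [← hpar]; exact hx⟩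
    let ν' : Measure T := ∑ b'' ∈ R, ν b''
    have happ : ∀ s, ν' s = ∑ b'' ∈ R, ν b'' s := fun s => by
      simp [ν', Measure.finsetSum_apply]
    have htop : ν' univ ≠ ∞ := by
      rw [happ]
      refine (ENNReal.sum_lt_top.2 fun b'' _ => ?_).ne
      rw [h1]
      exact (cont_cell_le _ _).trans_lt (hw _).lt_top
    have hle : cont q w {x | q k x = b} ≤ ν' univ := by
      rw [happ]
      simp_rw [h1]
      have : {x | q k x = b} ⊆ ⋃ b'' : R, {x | q (k + 1) x = b''.1} := fun x hx =>
        mem_iUnion.2 ⟨⟨_, hR x hx⟩, rfl⟩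
      refine (cont_mono this).trans ((cont_iUnion _).trans ?_)
      rw [tsum_fintype, Finset.sum_coe_sort R (fun b'' => cont q w {x | q (k + 1) x = b''})]
    set a := cont q w {x | q k x = b} with ha
    have huniv : a / ν' univ * ν' univ = a := by
      by_cases h0 : ν' univ = 0
      · rw [h0] at hle ⊢
        rw [mul_zero]; exact (le_antisymm hle zero_le).symm
      · exact ENNReal.div_mul_cancel h0 htop
    refine ⟨(a / ν' univ) • ν', by simpa using huniv, ?_, ?_⟩
    · rw [Measure.smul_apply, happ {x | q k x ≠ b}, Finset.sum_eq_zero, smul_zero]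
      intro b'' hb''
      refine measure_mono_null ?_ (h2 b'')
      intro x hx hx'
      apply hx
      rw [hpar, hx']
      exact (Finset.mem_filter.1 hb'').2
    · intro l hl hl' b'
      rcases hl.eq_or_lt with rfl | hl
      · refine (measure_mono (subset_univ _)).trans ?_
        rw [Measure.smul_apply, smul_eq_mul, huniv]
        exact cont_cell_le _ b
      · rw [Measure.smul_apply, smul_eq_mul]
        refine (mul_le_of_le_one_left' (ENNReal.div_le_of_le_mul (by simpa using hle))).trans ?_
        rw [happ]
        have hz : ∀ b'' ∈ R, b'' ≠ par^[l - (k + 1)] b' → ν b'' {x | q l x = b'} = 0 := by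
          intro b'' _ hne
          refine measure_mono_null ?_ (h2 b'')
          intro x hx hx'
          apply hne
          rw [← hx', ← anc' hpar x (show k + 1 ≤ l from hl), hx]
        by_cases hm : par^[l - (k + 1)] b' ∈ R
        · rw [Finset.sum_eq_single_of_mem _ hm hz]
          exact h3 _ l hl (by omega) b'
        · rw [Finset.sum_eq_zero]
          · exact zero_le
          · intro b'' hb''
            exact hz b'' hb'' (fun h => hm (h ▸ hb''))

theorem exists_measure [TopologicalSpace T] [CompactSpace T] [T2Space T] [MeasurableSpace T]
    [BorelSpace T] [TopologicalSpace.PseudoMetrizableSpace T]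
    [SecondCountableTopology T] [Countable β]
    [TopologicalSpace β] [DiscreteTopology β] {q : ℕ → T → β}
    (hq : ∀ k, Continuous (q k)) (hpar : ∀ k x, q k x = par (q (k + 1) x))
    (hw : ∀ k, w k ≠ ∞) (h : cont q w univ ≠ 0) :
    ∃ ν : Measure T, IsProbabilityMeasure ν ∧ ∃ C : ℝ≥0∞, C ≠ ∞ ∧
      ∀ k b, ν {x | q k x = b} ≤ C * w k := by
  have hfin : ∀ k, (range (q k)).Finite := fun k =>
    (isCompact_range (hq k)).finite_of_discrete
  obtain ⟨b, hb⟩ : ∃ b, cont q w {x | q 0 x = b} ≠ 0 := by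
    by_contra! hcon
    apply h
    have : (univ : Set T) = ⋃ b, {x | q 0 x = b} := by ext; simp
    rw [this]
    refine le_antisymm ((cont_iUnion _).trans ?_) zero_le
    simp [hcon]
  set c := cont q w {x | q 0 x = b}
  have hct : c ≠ ∞ := ne_top_of_le_ne_top (hw 0) (cont_cell_le 0 b)
  choose ν h1 h2 h3 using fun N => exists_level (w := w) hpar
    (fun k b' => ((isClopen_discrete {b'}).preimage (hq k)).isOpen.measurableSet) hfin hw N 0 b
  let P : ℕ → ProbabilityMeasure T := fun N => ⟨c⁻¹ • ν N, ⟨by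
    rw [Measure.smul_apply, h1, smul_eq_mul, ENNReal.inv_mul_cancel hb hct]⟩⟩
  obtain ⟨μ, -, hμ⟩ := (isCompact_univ (X := ProbabilityMeasure T)).ultrafilter_le_nhds
    ((hyperfilter ℕ).map P) (by simp)
  have hμ' : Tendsto P (hyperfilter ℕ) (𝓝 μ) := hμ
  refine ⟨μ, inferInstance, c⁻¹, ENNReal.inv_ne_top.2 hb, fun k b' => ?_⟩
  have hcl : IsClopen {x | q k x = b'} := (isClopen_discrete {b'}).preimage (hq k)
  have ht := ProbabilityMeasure.tendsto_measure_of_isClopen_of_tendsto hμ' hcl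
  have ht' : Tendsto (fun i => ((P i : Measure T)) {x | q k x = b'}) (hyperfilter ℕ)
      (𝓝 ((μ : Measure T) {x | q k x = b'})) := by
    have := (ENNReal.continuous_coe.tendsto _).comp ht
    simpa [Function.comp_def] using this
  refine le_of_tendsto ht' ?_
  have : ∀ᶠ N in (hyperfilter ℕ : Filter ℕ), k ≤ N :=
    Nat.hyperfilter_le_atTop (eventually_ge_atTop k)
  filter_upwards [this] with N hN
  change (c⁻¹ • ν N) _ ≤ _
  rw [Measure.smul_apply, smul_eq_mul]
  gcongr
  exact h3 N k (Nat.zero_le _) (by omega) b'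

end
end FrostAux

namespace FrostAux

open scoped ENNReal NNReal Topology
open MeasureTheory Set Filter

lemma cont_map {T T' β : Type*} {q : ℕ → T → β} {q' : ℕ → T' → β} {w : ℕ → ℝ≥0∞}
    {A : Set T} {B : Set T'} (h : ∀ x ∈ A, ∃ y ∈ B, ∀ k, q k x = q' k y) :
    cont q w A ≤ cont q' w B := by
  refine le_iInf₂ fun W hW => cont_le fun x hx => ?_
  obtain ⟨y, hy, hxy⟩ := h x hx
  obtain ⟨k, hk⟩ := hW y hy
  exact ⟨k, by rw [hxy]; exact hk⟩

/-- dyadic code -/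
noncomputable def dy {n : ℕ} (x : Fin n → ℝ) : ℕ → (Fin n → ℤ) := fun k i => ⌊(2:ℝ) ^ k * x i⌋

noncomputable def wt (s : ℝ) (k : ℕ) : ℝ≥0∞ := ENNReal.ofReal (((1 / 2 : ℝ) ^ k) ^ s)

lemma dy_par {n : ℕ} (x : Fin n → ℝ) (k : ℕ) :
    dy x k = (fun (b : Fin n → ℤ) i => b i / 2) (dy x (k + 1)) := by
  funext i
  simp only [dy]
  have := Int.floor_div_natCast ((2:ℝ) ^ (k + 1) * x i) 2
  push_cast at this
  rw [← this]
  congr 1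
  ring

lemma dy_measurable {n : ℕ} : Measurable (dy (n := n)) := by
  refine measurable_pi_iff.2 fun k => measurable_pi_iff.2 fun i => ?_
  exact ((measurable_pi_apply i).const_mul _).floor

lemma dy_dist {n : ℕ} {x y : Fin n → ℝ} {k : ℕ} (h : dy x k = dy y k) :
    dist x y ≤ (1 / 2 : ℝ) ^ k := by
  rw [dist_pi_le_iff (by positivity)]
  intro i
  have h1 := congrFun h i
  simp only [dy] at h1
  have h2 := Int.abs_sub_lt_one_of_floor_eq_floor h1
  rw [← mul_sub, abs_mul, abs_of_pos (by positivity)] at h2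
  rw [Real.dist_eq, one_div, inv_pow, ← one_div, le_div_iff₀ (by positivity), mul_comm]
  exact h2.le

lemma dy_injective {n : ℕ} : Function.Injective (dy (n := n)) := by
  intro x y h
  have h1 : ∀ k : ℕ, dist x y ≤ (1 / 2 : ℝ) ^ k := fun k => dy_dist (congrFun h k)
  have h2 : dist x y ≤ 0 := ge_of_tendsto' (tendsto_pow_atTop_nhds_zero_of_lt_one
    (by norm_num) (by norm_num)) h1
  exact dist_le_zero.1 h2

lemma hausdorff_zero {n : ℕ} {E : Set (Fin n → ℝ)} {s : ℝ} (hs : 0 < s)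
    (h : cont (fun k x => dy x k) (wt s) E = 0) : μH[s] E = 0 := by
  have hpos : ∀ k, 0 < wt s k := fun k => by unfold wt; positivity
  have : ∀ k : ℕ, ∃ W, Cov (fun k x => dy x k) W E ∧ cost (wt s) W < wt s k := fun k =>
    exists_cov (by rw [h]; exact hpos k)
  choose W hW hc using this
  have hlev : ∀ k, ∀ p ∈ W k, k ≤ p.1 := by
    intro k p hp
    by_contra! hlt
    have h1 : wt s p.1 ≤ cost (wt s) (W k) := by
      unfold cost
      refine le_trans ?_ (ENNReal.le_tsum p)
      rw [indicator_of_mem hp]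
    have h2 : wt s k ≤ wt s p.1 := by
      unfold wt
      refine ENNReal.ofReal_le_ofReal (Real.rpow_le_rpow (by positivity) ?_ hs.le)
      exact pow_le_pow_of_le_one (by norm_num) (by norm_num) hlt.le
    exact absurd (hc k) (not_lt.2 (h2.trans h1))
  have hwt0 : Tendsto (wt s) atTop (𝓝 0) := by
    unfold wt
    rw [← ENNReal.ofReal_zero]
    refine ENNReal.tendsto_ofReal ?_
    have := (tendsto_pow_atTop_nhds_zero_of_lt_one (r := (1/2:ℝ)) (by norm_num)
      (by norm_num)).rpow_const (p := s) (Or.inr hs.le)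
    rwa [Real.zero_rpow hs.ne'] at this
  have hr : Tendsto (fun k : ℕ => ENNReal.ofReal ((1 / 2 : ℝ) ^ k)) atTop (𝓝 0) := by
    rw [← ENNReal.ofReal_zero]
    exact ENNReal.tendsto_ofReal (tendsto_pow_atTop_nhds_zero_of_lt_one (by norm_num)
      (by norm_num))
  let t : ℕ → (ℕ × (Fin n → ℤ)) → Set (Fin n → ℝ) := fun k p =>
    {x | p ∈ W k ∧ dy x p.1 = p.2}
  have hdiam : ∀ k p, Metric.ediam (t k p) ≤ ENNReal.ofReal ((1 / 2 : ℝ) ^ p.1) := by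
    intro k p
    refine Metric.ediam_le fun x hx y hy => ?_
    rw [edist_dist]
    exact ENNReal.ofReal_le_ofReal (dy_dist (hx.2.trans hy.2.symm))
  have hempty : ∀ k p, p ∉ W k → t k p = ∅ := fun k p hp =>
    eq_empty_of_forall_notMem fun x hx => hp hx.1
  have key := Measure.hausdorffMeasure_le_liminf_tsum s E (l := atTop)
    (fun k : ℕ => ENNReal.ofReal ((1 / 2 : ℝ) ^ k)) hr t
    (Eventually.of_forall fun k p => ?_) (Eventually.of_forall fun k x hx => ?_)
  · refine le_antisymm (key.trans ?_) zero_le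
    have hle : ∀ k, ∑' p, Metric.ediam (t k p) ^ s ≤ wt s k := by
      intro k
      refine le_trans ?_ (hc k).le
      unfold cost
      refine ENNReal.tsum_le_tsum fun p => ?_
      by_cases hp : p ∈ W k
      · rw [indicator_of_mem hp]
        refine (ENNReal.rpow_le_rpow (hdiam k p) hs.le).trans ?_
        rw [ENNReal.ofReal_rpow_of_pos (by positivity)]
        rfl
      · rw [hempty k p hp]; simp [ENNReal.zero_rpow_of_pos hs]
    refine (liminf_le_liminf (Eventually.of_forall hle)).trans ?_
    rw [hwt0.liminf_eq]
  · by_cases hp : p ∈ W k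
    · refine (hdiam k p).trans (ENNReal.ofReal_le_ofReal ?_)
      exact pow_le_pow_of_le_one (by norm_num) (by norm_num) (hlev k p hp)
    · rw [hempty k p hp]; simp
  · obtain ⟨l, hl⟩ := hW k x hx
    exact mem_iUnion.2 ⟨(l, dy x l), hl, rfl⟩

theorem frostman {n : ℕ} {E : Set (Fin n → ℝ)} (hE : MeasurableSet E) {s : ℝ} (hs : 0 < s)
    (h : μH[s] E ≠ 0) : ∃ μ : Measure (Fin n → ℝ), IsProbabilityMeasure μ ∧ μ Eᶜ = 0 ∧
      ∃ C : ℝ≥0∞, C ≠ ∞ ∧ ∀ x, ∀ r : ℝ, 0 < r →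
        μ (Metric.closedBall x r) ≤ C * ENNReal.ofReal (r ^ s) := by
  have hcont : cont (fun k x => dy x k) (wt s) E ≠ 0 := fun h0 => h (hausdorff_zero hs h0)
  have hemb : MeasurableEmbedding (dy (n := n)) := dy_measurable.measurableEmbedding dy_injective
  have hA : AnalyticSet (dy '' E) := (hemb.measurableSet_image' hE).analyticSet
  rw [AnalyticSet] at hA
  have hEne : E.Nonempty := by
    rw [nonempty_iff_ne_empty]; rintro rfl; simp at h
  obtain ⟨f, hf, hfr⟩ := hA.resolve_left (hEne.image _).ne_empty
  let par : (Fin n → ℤ) → (Fin n → ℤ) := fun b i => b i / 2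
  have hfE : ∀ p, ∃ x ∈ E, dy x = f p := fun p => by
    have : f p ∈ dy '' E := hfr ▸ mem_range_self p
    exact this
  choose g hgE hg using hfE
  have hq : ∀ k, Continuous (fun p => f p k) := fun k => (continuous_apply k).comp hf
  have hpar : ∀ k p, f p k = par (f p (k + 1)) := fun k p => by
    rw [← hg p]; exact dy_par _ _
  have h1 : cont (fun k p => f p k) (wt s) univ ≠ 0 := by
    refine ne_of_gt (lt_of_lt_of_le (pos_iff_ne_zero.2 hcont) (cont_map fun x hx => ?_))
    have : dy x ∈ range f := hfr ▸ mem_image_of_mem _ hx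
    obtain ⟨p, hp⟩ := this
    exact ⟨p, mem_univ _, fun k => by rw [hp]⟩
  obtain ⟨L, hL, hL0⟩ := exists_compact hq hpar h1
  have : CompactSpace L := isCompact_iff_compactSpace.1 hL
  have h2 : cont (fun k (p : L) => f p.1 k) (wt s) univ ≠ 0 := by
    refine ne_of_gt (lt_of_lt_of_le (pos_iff_ne_zero.2 hL0) (cont_map fun x hx => ?_))
    exact ⟨⟨x, hx⟩, mem_univ _, fun k => rfl⟩
  obtain ⟨ν, hν, C, hC, hνC⟩ := exists_measure (par := par) (w := wt s)
    (q := fun k (p : L) => f p.1 k)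
    (fun k => (hq k).comp continuous_subtype_val) (fun k p => hpar k p.1)
    (fun k => ENNReal.ofReal_ne_top) h2
  let G : L → (Fin n → ℝ) := fun p => g p.1
  have hG : Measurable G := by
    rw [← hemb.measurable_comp_iff]
    have : dy ∘ G = f ∘ Subtype.val := by funext p; exact hg p.1
    rw [this]
    exact hf.measurable.comp measurable_subtype_coe
  have hprob : IsProbabilityMeasure (ν.map G) := Measure.isProbabilityMeasure_map hG.aemeasurable
  have hcell : ∀ k b, (ν.map G) {x | dy x k = b} ≤ C * wt s k := by
    intro k b
    have hms : MeasurableSet {x : Fin n → ℝ | dy x k = b} :=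
      ((measurable_pi_apply k).comp dy_measurable) (measurableSet_singleton b)
    rw [Measure.map_apply hG hms]
    convert hνC k b using 2
    ext p
    simp only [mem_preimage, mem_ofPred_eq, G, hg]
  refine ⟨ν.map G, hprob, ?_, 1 + 3 ^ n * C * ENNReal.ofReal (2 ^ s), ?_, ?_⟩
  · rw [Measure.map_apply hG hE.compl]
    have : G ⁻¹' Eᶜ = ∅ := eq_empty_of_forall_notMem fun p hp => hp (hgE p.1)
    rw [this]; simp
  · finiteness
  · intro x r hr
    rw [add_mul, one_mul]
    rcases le_or_gt 1 r with h1r | hr1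
    · refine le_add_right (prob_le_one.trans ?_)
      rw [ENNReal.one_le_ofReal]
      exact Real.one_le_rpow h1r hs.le
    · refine le_add_left ?_
      obtain ⟨k, hk1, hk2⟩ := exists_nat_pow_near_of_lt_one hr hr1.le
        (y := (1/2:ℝ)) (by norm_num) (by norm_num)
      let R : Finset (Fin n → ℤ) := Fintype.piFinset fun i =>
        Finset.Icc (dy x k i - 1) (dy x k i + 1)
      have hcard : R.card = 3 ^ n := by
        simp only [R, Fintype.card_piFinset, Int.card_Icc]
        have : ∀ i, (dy x k i + 1 + 1 - (dy x k i - 1)).toNat = 3 := fun i => by omega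
        simp [this]
      have hsub : Metric.closedBall x r ⊆ ⋃ b ∈ R, {y | dy y k = b} := by
        intro y hy
        simp only [mem_iUnion, mem_ofPred_eq, exists_prop, exists_eq_right']
        rw [Fintype.mem_piFinset]
        intro i
        have h3 : dist (y i) (x i) ≤ (1 / 2 : ℝ) ^ k :=
          (dist_le_pi_dist y x i).trans ((Metric.mem_closedBall.1 hy).trans hk2)
        rw [Real.dist_eq, one_div, inv_pow, ← one_div, le_div_iff₀ (by positivity), mul_comm,
          ← abs_of_pos (show (0:ℝ) < 2 ^ k by positivity), ← abs_mul, mul_sub, abs_le] at h3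
        simp only [dy]
        rw [Finset.mem_Icc]
        constructor
        · rw [← Int.floor_sub_one]; exact Int.floor_le_floor (by linarith)
        · rw [← Int.floor_add_one]; exact Int.floor_le_floor (by linarith)
      calc (ν.map G) (Metric.closedBall x r) ≤ ∑ b ∈ R, (ν.map G) {y | dy y k = b} :=
            (measure_mono hsub).trans (measure_biUnion_finset_le _ _)
        _ ≤ ∑ b ∈ R, C * wt s k := Finset.sum_le_sum fun b _ => hcell k b
        _ = 3 ^ n * C * wt s k := by
            rw [Finset.sum_const, hcard, nsmul_eq_mul]; push_cast; ring
        _ ≤ 3 ^ n * C * (ENNReal.ofReal (2 ^ s) * ENNReal.ofReal (r ^ s)) := by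
            gcongr
            unfold wt
            rw [← ENNReal.ofReal_mul (by positivity), ← Real.mul_rpow (by norm_num) hr.le]
            refine ENNReal.ofReal_le_ofReal (Real.rpow_le_rpow (by positivity) ?_ hs.le)
            rw [pow_succ] at hk1
            linarith
        _ = _ := by ring

end FrostAux

namespace FrostAux

open scoped ENNReal NNReal Topology
open MeasureTheory Set Filter

theorem disint {m : ℕ} (ρ : Measure ((Fin m → ℝ) × ℝ)) [IsProbabilityMeasure ρ]
    {F : Set ((Fin m → ℝ) × ℝ)} (hF0 : ∀ᵐ p ∂ρ, p ∈ F)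
    (hcount : ∀ y, {t | (y, t) ∈ F}.Countable)
    (hbad : ∀ᵐ p ∂ρ, ⨅ k : ℕ, liminf (fun j : ℕ =>
      ρ (Metric.closedBall p.1 ((1 / 2 : ℝ) ^ j) ×ˢ Metric.closedBall p.2 ((1 / 2 : ℝ) ^ (k + 1)))
        / (ENNReal.ofReal ((1 / 2 : ℝ) ^ j)) ^ m) atTop = 0) : False := by
  set ν := ρ.fst with hν
  set κ := ρ.condKernel with hκ
  have hdis : ν.compProd κ = ρ := ρ.disintegrate ρ.condKernel
  have hF1 : ∀ᵐ y ∂ν, ∀ᵐ t ∂κ y, (y, t) ∈ F :=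
    Measure.ae_ae_of_ae_compProd (by rw [hdis]; exact hF0)
  have hbad1 := Measure.ae_ae_of_ae_compProd (μ := ν) (κ := κ) (by rw [hdis]; exact hbad)
  have hpos : ∀ᵐ y ∂ν, ∀ᵐ t ∂κ y, κ y {t} ≠ 0 := by
    filter_upwards [hF1] with y hy
    have h1 : κ y {t | (y, t) ∈ F ∧ κ y {t} = 0} = 0 := by
      have hc : {t | (y, t) ∈ F ∧ κ y {t} = 0}.Countable :=
        (hcount y).mono fun t ht => ht.1
      rw [← biUnion_of_singleton {t | (y, t) ∈ F ∧ κ y {t} = 0},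
        measure_biUnion_null_iff hc]
      exact fun t ht => ht.2
    have h2 : ∀ᵐ t ∂κ y, ¬ ((y, t) ∈ F ∧ κ y {t} = 0) := by
      rw [ae_iff]; simpa using h1
    filter_upwards [hy, h2] with t ht ht2 h0 using ht2 ⟨ht, h0⟩
  let J : ℕ → ℤ → Set ℝ := fun k p => {t | ⌊(2:ℝ) ^ (k + 1) * t⌋ = p}
  have hJm : ∀ k p, MeasurableSet (J k p) := fun k p =>
    (measurable_id.const_mul ((2:ℝ) ^ (k + 1))).floor (measurableSet_singleton p)
  have hdens : ∀ k p, ∀ᵐ y ∂ν, Tendsto (fun r => ρ (Metric.closedBall y r ×ˢ J k p) /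
      ν (Metric.closedBall y r)) (𝓝[>] 0) (𝓝 (κ y (J k p))) := by
    intro k p
    have hfm : Measurable (fun y => κ y (J k p)) := κ.measurable_coe (hJm k p)
    have : IsFiniteMeasure (ν.withDensity fun y => κ y (J k p)) := by
      refine isFiniteMeasure_withDensity (ne_of_lt ?_)
      calc ∫⁻ y, κ y (J k p) ∂ν ≤ ∫⁻ y, 1 ∂ν := lintegral_mono fun y => prob_le_one
        _ < ∞ := by simp
    have hval : ∀ y r, (ν.withDensity fun y => κ y (J k p)) (Metric.closedBall y r) =
        ρ (Metric.closedBall y r ×ˢ J k p) := by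
      intro y r
      rw [withDensity_apply _ measurableSet_closedBall, ← hdis,
        Measure.compProd_apply_prod measurableSet_closedBall (hJm k p)]
    filter_upwards [Besicovitch.ae_tendsto_rnDeriv (ν.withDensity fun y => κ y (J k p)) ν,
      Measure.rnDeriv_withDensity ν hfm] with y hy hy2
    rw [hy2] at hy
    simpa only [hval] using hy
  have hdens' : ∀ᵐ y ∂ν, ∀ k p, Tendsto (fun r => ρ (Metric.closedBall y r ×ˢ J k p) /
      ν (Metric.closedBall y r)) (𝓝[>] 0) (𝓝 (κ y (J k p))) := by
    rw [ae_all_iff]; intro k; rw [ae_all_iff]; exact hdens k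
  have hvol := Besicovitch.ae_tendsto_rnDeriv (volume : Measure (Fin m → ℝ)) ν
  have hfin := Measure.rnDeriv_lt_top (volume : Measure (Fin m → ℝ)) ν
  obtain ⟨y, hy1, hy2, hy3, hy4, hy5⟩ :=
    (hbad1.and (hpos.and (hdens'.and (hvol.and hfin)))).exists
  obtain ⟨t, ht1, ht2⟩ := (hy1.and hy2).exists
  set c := κ y {t} with hc
  have hct : c ≠ ∞ := measure_ne_top _ _
  set w := (volume : Measure (Fin m → ℝ)).rnDeriv ν y + 1 with hw
  have hwt : w ≠ ∞ := by rw [hw]; exact ENNReal.add_ne_top.2 ⟨hy5.ne, ENNReal.one_ne_top⟩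
  have hw0 : w ≠ 0 := by rw [hw]; simp
  have hseq : Tendsto (fun j : ℕ => (1 / 2 : ℝ) ^ j) atTop (𝓝[>] 0) := by
    refine tendsto_nhdsWithin_iff.2 ⟨tendsto_pow_atTop_nhds_zero_of_lt_one (by norm_num)
      (by norm_num), Eventually.of_forall fun j => ?_⟩
    rw [mem_Ioi]; positivity
  have hge : c / 2 / w ≤ ⨅ k : ℕ, liminf (fun j : ℕ =>
      ρ (Metric.closedBall y ((1 / 2 : ℝ) ^ j) ×ˢ Metric.closedBall t ((1 / 2 : ℝ) ^ (k + 1)))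
        / (ENNReal.ofReal ((1 / 2 : ℝ) ^ j)) ^ m) atTop := by
    refine le_iInf fun k => ?_
    have htJ : t ∈ J k ⌊(2:ℝ) ^ (k + 1) * t⌋ := rfl
    have hJsub : J k ⌊(2:ℝ) ^ (k + 1) * t⌋ ⊆ Metric.closedBall t ((1 / 2 : ℝ) ^ (k + 1)) := by
      intro u hu
      have h2 := Int.abs_sub_lt_one_of_floor_eq_floor (show ⌊(2:ℝ) ^ (k + 1) * u⌋ = _ from hu)
      rw [← mul_sub, abs_mul, abs_of_pos (by positivity)] at h2
      rw [Metric.mem_closedBall, Real.dist_eq, one_div, inv_pow, ← one_div,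
        le_div_iff₀ (by positivity), mul_comm]
      exact h2.le
    have hcJ : c / 2 < κ y (J k ⌊(2:ℝ) ^ (k + 1) * t⌋) :=
      lt_of_lt_of_le (ENNReal.half_lt_self ht2 hct)
        (measure_mono (singleton_subset_iff.2 htJ))
    have e1 := hseq.eventually ((hy3 k ⌊(2:ℝ) ^ (k + 1) * t⌋).eventually_const_lt hcJ)
    have e2 := hseq.eventually (hy4.eventually_lt_const
      (ENNReal.lt_add_right hy5.ne one_ne_zero))
    refine le_liminf_of_le (by isBoundedDefault) ?_
    filter_upwards [e1, e2] with j h1 h2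
    have h3 := (ENNReal.div_le_iff_le_mul (Or.inr hwt) (Or.inr hw0)).1 h2.le
    have h4 := ENNReal.mul_le_of_le_div h1.le
    have hδ : (0:ℝ) ≤ (1 / 2 : ℝ) ^ j := by positivity
    rw [Real.volume_pi_closedBall _ hδ, Fintype.card_fin] at h3
    rw [ENNReal.le_div_iff_mul_le (Or.inl (by positivity)) (Or.inl (by finiteness))]
    refine le_trans ?_ (h4.trans (measure_mono (prod_mono le_rfl hJsub)))
    rw [div_eq_mul_inv (c / 2) w, mul_assoc]
    gcongr
    rw [mul_comm, ← div_eq_mul_inv]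
    refine ENNReal.div_le_of_le_mul' (le_trans ?_ h3)
    rw [← ENNReal.ofReal_pow hδ]
    exact ENNReal.ofReal_le_ofReal (pow_le_pow_left₀ hδ (by linarith) m)
  simp only at ht1
  rw [ht1] at hge
  have : c / 2 / w = 0 := le_antisymm hge zero_le
  rw [ENNReal.div_eq_zero_iff, ENNReal.div_eq_zero_iff] at this
  rcases this with (h | h) | h
  · exact ht2 h
  · exact absurd h (by simp)
  · exact hwt h

end FrostAux

namespace FrostAux

open scoped ENNReal NNReal Topology
open MeasureTheory Set Filter

/-- terms of the energy series -/
noncomputable def ea (m : ℕ) (s : ℝ) (C : ℝ≥0∞) (l : ℕ) : ℝ≥0∞ :=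
  ENNReal.ofReal ((2:ℝ) ^ (l + 1)) ^ m * (C * ENNReal.ofReal (((1 / 2 : ℝ) ^ l) ^ s))

lemma ea_sum {m : ℕ} {s : ℝ} (hs : (m : ℝ) < s) {C : ℝ≥0∞} (hC : C ≠ ∞) :
    ∑' l, ea m s C l ≠ ∞ := by
  have h1 : ∀ l, ea m s C l = C * 2 ^ m * ENNReal.ofReal ((1 / 2 : ℝ) ^ (s - m)) ^ l := by
    intro l
    unfold ea
    have e2 : (2 : ℝ≥0∞) ^ m = ENNReal.ofReal (2 ^ m) := by
      rw [ENNReal.ofReal_pow (by norm_num)]; norm_num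
    rw [mul_left_comm, mul_assoc, e2, ← ENNReal.ofReal_pow (by positivity),
      ← ENNReal.ofReal_pow (by positivity), ← ENNReal.ofReal_mul (by positivity),
      ← ENNReal.ofReal_mul (by positivity)]
    congr 2
    have : (((1 / 2 : ℝ) ^ l) ^ s) = ((1 / 2 : ℝ) ^ (s - m)) ^ l * ((1 / 2 : ℝ) ^ l) ^ m := by
      rw [← Real.rpow_natCast (1 / 2 : ℝ) l, ← Real.rpow_mul (by norm_num),
        ← Real.rpow_natCast (((1 / 2 : ℝ) ^ (s - m))) l, ← Real.rpow_mul (by norm_num),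
        ← Real.rpow_natCast _ m, ← Real.rpow_mul (by norm_num), ← Real.rpow_add (by norm_num)]
      congr 1; ring
    rw [this, pow_succ, mul_pow]
    have h2 : ((2:ℝ) ^ l) ^ m * ((1 / 2 : ℝ) ^ l) ^ m = 1 := by
      rw [← mul_pow, ← mul_pow]; norm_num
    linear_combination (2 ^ m * ((1 / 2 : ℝ) ^ (s - m)) ^ l) * h2
  simp_rw [h1]
  rw [ENNReal.tsum_mul_left, ENNReal.tsum_geometric]
  refine ENNReal.mul_ne_top (by finiteness) (ENNReal.inv_ne_top.2 ?_)
  rw [Ne, tsub_eq_zero_iff_le, not_le, ← ENNReal.ofReal_one]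
  exact (ENNReal.ofReal_lt_ofReal_iff (by norm_num)).2
    (Real.rpow_lt_one (by norm_num) (by norm_num) (by linarith))

lemma energy {X : Type*} [MetricSpace X] [MeasurableSpace X] [OpensMeasurableSpace X]
    {m : ℕ} {s : ℝ} {C : ℝ≥0∞} {μ : Measure X} (x : X) (hx : μ {x} = 0)
    (hμ : ∀ r : ℝ, 0 < r → μ (Metric.closedBall x r) ≤ C * ENNReal.ofReal (r ^ s)) (k : ℕ) :
    ∫⁻ y in Metric.closedBall x ((1 / 2 : ℝ) ^ k), (ENNReal.ofReal (dist x y))⁻¹ ^ m ∂μ ≤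
      ∑' l, ea m s C (l + k) := by
  rw [← lintegral_indicator measurableSet_closedBall]
  have hne : ∀ᵐ y ∂μ, y ≠ x := by rw [ae_iff]; simpa using hx
  calc ∫⁻ y, (Metric.closedBall x ((1 / 2 : ℝ) ^ k)).indicator
        (fun y => (ENNReal.ofReal (dist x y))⁻¹ ^ m) y ∂μ
      ≤ ∫⁻ y, ∑' l : ℕ, (Metric.closedBall x ((1 / 2 : ℝ) ^ (l + k))).indicator
        (fun _ => ENNReal.ofReal ((2:ℝ) ^ (l + k + 1)) ^ m) y ∂μ := by
        refine lintegral_mono_ae ?_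
        filter_upwards [hne] with y hy
        by_cases hyk : y ∈ Metric.closedBall x ((1 / 2 : ℝ) ^ k)
        · rw [indicator_of_mem hyk]
          have hd : 0 < dist x y := dist_pos.2 hy.symm
          have hyk' : dist x y ≤ (1 / 2 : ℝ) ^ k := by rw [dist_comm]; exact hyk
          obtain ⟨l, hl1, hl2⟩ := exists_nat_pow_near_of_lt_one hd
            (hyk'.trans (pow_le_one₀ (by norm_num) (by norm_num)))
            (y := (1/2:ℝ)) (by norm_num) (by norm_num)
          have hkl : k ≤ l := by
            by_contra! hlt
            have := pow_le_pow_of_le_one (a := (1/2:ℝ)) (by norm_num) (by norm_num)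
              (show l + 1 ≤ k from hlt)
            linarith
          obtain ⟨d, rfl⟩ := Nat.exists_eq_add_of_le hkl
          rw [add_comm k d] at hl1 hl2
          refine le_trans ?_ (ENNReal.le_tsum d)
          rw [indicator_of_mem (by rw [Metric.mem_closedBall, dist_comm]; exact hl2)]
          gcongr
          rw [← ENNReal.ofReal_inv_of_pos hd]
          refine ENNReal.ofReal_le_ofReal ?_
          rw [inv_le_comm₀ hd (by positivity), ← inv_pow, ← one_div]
          exact hl1.le
        · rw [indicator_of_notMem hyk]; exact zero_le
    _ = ∑' l : ℕ, ENNReal.ofReal ((2:ℝ) ^ (l + k + 1)) ^ m *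
          μ (Metric.closedBall x ((1 / 2 : ℝ) ^ (l + k))) := by
        rw [lintegral_tsum]
        · congr 1; funext l
          rw [lintegral_indicator_const measurableSet_closedBall]
        · intro l
          exact (measurable_const.indicator measurableSet_closedBall).aemeasurable
    _ ≤ _ := by
        refine ENNReal.tsum_le_tsum fun l => ?_
        unfold ea
        gcongr
        exact hμ _ (by positivity)

lemma dirs {m : ℕ} (a : Fin m → ℝ) (b : ℝ) (hz : (a, b) ≠ (0 : (Fin m → ℝ) × ℝ)) {δ : ℝ}
    (hδ : 0 < δ) :
    volume {θ : Fin m → ℝ | ‖θ‖ ≤ 1 ∧ ‖a - b • θ‖ ≤ δ} ≤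
      ENNReal.ofReal (4 * δ) ^ m * (ENNReal.ofReal ‖(a, b)‖)⁻¹ ^ m := by
  set z := ‖(a, b)‖ with hzdef
  have hz0 : 0 < z := norm_pos_iff.2 hz
  have hzmax : z = max ‖a‖ |b| := by rw [hzdef, Prod.norm_def]; rfl
  rw [← mul_pow, ← ENNReal.ofReal_inv_of_pos hz0, ← ENNReal.ofReal_mul (by positivity),
    ← ENNReal.ofReal_pow (by positivity)]
  rcases lt_or_ge |b| (z / 2) with hb | hb
  · have ha : z = ‖a‖ := by
      rcases max_choice ‖a‖ |b| with h | h
      · rw [hzmax, h]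
      · rw [h] at hzmax; linarith
    by_cases hδz : z / 2 ≤ δ
    · calc volume {θ : Fin m → ℝ | ‖θ‖ ≤ 1 ∧ ‖a - b • θ‖ ≤ δ}
          ≤ volume (Metric.closedBall (0 : Fin m → ℝ) 1) :=
            measure_mono fun θ hθ => mem_closedBall_zero_iff.2 hθ.1
        _ = ENNReal.ofReal ((2 * 1) ^ m) := by
            rw [Real.volume_pi_closedBall _ zero_le_one, Fintype.card_fin]
        _ ≤ _ := by
            refine ENNReal.ofReal_le_ofReal (pow_le_pow_left₀ (by norm_num) ?_ m)
            rw [← div_eq_mul_inv, le_div_iff₀ hz0]; linarith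
    · have : {θ : Fin m → ℝ | ‖θ‖ ≤ 1 ∧ ‖a - b • θ‖ ≤ δ} = ∅ := by
        refine eq_empty_of_forall_notMem fun θ hθ => hδz ?_
        have h1 := norm_sub_norm_le a (b • θ)
        have h2 : ‖b • θ‖ ≤ |b| := by
          rw [norm_smul, Real.norm_eq_abs]
          exact mul_le_of_le_one_right (abs_nonneg b) hθ.1
        have := hθ.2
        linarith
      rw [this]; simp
  · have hb0 : 0 < |b| := by linarith
    have hbne : b ≠ 0 := abs_pos.1 hb0
    calc volume {θ : Fin m → ℝ | ‖θ‖ ≤ 1 ∧ ‖a - b • θ‖ ≤ δ}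
        ≤ volume (Metric.closedBall (b⁻¹ • a) (δ / |b|)) := by
          refine measure_mono fun θ hθ => ?_
          rw [Metric.mem_closedBall, dist_comm, dist_eq_norm, le_div_iff₀ hb0,
            ← Real.norm_eq_abs, mul_comm, ← norm_smul, smul_sub, smul_inv_smul₀ hbne]
          exact hθ.2
      _ = ENNReal.ofReal ((2 * (δ / |b|)) ^ m) := by
          rw [Real.volume_pi_closedBall _ (by positivity), Fintype.card_fin]
      _ ≤ _ := by
          refine ENNReal.ofReal_le_ofReal (pow_le_pow_left₀ (by positivity) ?_ m)
          rw [← div_eq_mul_inv, ← mul_div_assoc, div_le_div_iff₀ hb0 hz0]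
          nlinarith

theorem slice {m : ℕ} (μ : Measure ((Fin m → ℝ) × ℝ)) [IsProbabilityMeasure μ] {s : ℝ}
    (hs : (m : ℝ) < s) {C : ℝ≥0∞} (hC : C ≠ ∞)
    (hμ : ∀ x, ∀ r : ℝ, 0 < r → μ (Metric.closedBall x r) ≤ C * ENNReal.ofReal (r ^ s))
    {E : Set ((Fin m → ℝ) × ℝ)} (hE : MeasurableSet E) (hE0 : μ Eᶜ = 0) {ε : ℝ} (hε : 0 < ε)
    (hε1 : ε ≤ 1)
    (hlines : ∀ θ : Fin m → ℝ, ‖θ‖ ≤ ε → ∀ x : (Fin m → ℝ) × ℝ,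
      {t : ℝ | x + t • (θ, (1:ℝ)) ∈ E}.Countable) : False := by
  have hs0 : 0 < s := lt_of_le_of_lt (Nat.cast_nonneg m) hs
  have hatom : ∀ x, μ {x} = 0 := by
    intro x
    have h1 : ∀ k : ℕ, μ {x} ≤ C * ENNReal.ofReal (((1 / 2 : ℝ) ^ k) ^ s) := fun k =>
      (measure_mono (singleton_subset_iff.2 (Metric.mem_closedBall_self (by positivity)))).trans
        (hμ x _ (by positivity))
    have h2 : Tendsto (fun k : ℕ => C * ENNReal.ofReal (((1 / 2 : ℝ) ^ k) ^ s)) atTop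
        (𝓝 (C * ENNReal.ofReal 0)) := by
      refine ENNReal.Tendsto.const_mul (ENNReal.tendsto_ofReal ?_) (Or.inr hC)
      have := (tendsto_pow_atTop_nhds_zero_of_lt_one (r := (1/2:ℝ)) (by norm_num)
        (by norm_num)).rpow_const (p := s) (Or.inr hs0.le)
      rwa [Real.zero_rpow hs0.ne'] at this
    rw [ENNReal.ofReal_zero, mul_zero] at h2
    exact le_antisymm (ge_of_tendsto' h2 h1) zero_le
  let σ : Measure (Fin m → ℝ) := volume.restrict (Metric.closedBall 0 ε)
  have hσfin : IsFiniteMeasure σ := by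
    refine ⟨?_⟩
    simp only [σ, Measure.restrict_apply_univ]
    exact measure_closedBall_lt_top
  let D : ℕ → ℕ → Set (((Fin m → ℝ) × ((Fin m → ℝ) × ℝ)) × ((Fin m → ℝ) × ℝ)) := fun k j =>
    {p | ‖(p.1.2.1 - p.2.1) - (p.1.2.2 - p.2.2) • p.1.1‖ ≤ (1 / 2 : ℝ) ^ j ∧
      |p.1.2.2 - p.2.2| ≤ (1 / 2 : ℝ) ^ (k + 1)}
  have hD : ∀ k j, MeasurableSet (D k j) := by
    intro k j
    have h1 : IsClosed {p : ((Fin m → ℝ) × ((Fin m → ℝ) × ℝ)) × ((Fin m → ℝ) × ℝ) |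
        ‖(p.1.2.1 - p.2.1) - (p.1.2.2 - p.2.2) • p.1.1‖ ≤ (1 / 2 : ℝ) ^ j} :=
      isClosed_le (by fun_prop) (by fun_prop)
    have h2 : IsClosed {p : ((Fin m → ℝ) × ((Fin m → ℝ) × ℝ)) × ((Fin m → ℝ) × ℝ) |
        |p.1.2.2 - p.2.2| ≤ (1 / 2 : ℝ) ^ (k + 1)} :=
      isClosed_le (by fun_prop) (by fun_prop)
    exact (h1.inter h2).measurableSet
  let g : ℕ → ℕ → (Fin m → ℝ) × ((Fin m → ℝ) × ℝ) → ℝ≥0∞ := fun k j p =>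
    μ (Prod.mk p ⁻¹' D k j) / ENNReal.ofReal ((1 / 2 : ℝ) ^ j) ^ m
  have hg : ∀ k j, Measurable (g k j) := fun k j =>
    (measurable_measure_prodMk_left (hD k j)).div_const _
  have hbound : ∀ k j, k + 1 ≤ j →
      ∫⁻ p, g k j p ∂(σ.prod μ) ≤ 4 ^ m * ∑' l, ea m s C (l + k) := by
    intro k j hkj
    rw [lintegral_prod_symm' _ (hg k j)]
    have hδ : (0:ℝ) < (1 / 2 : ℝ) ^ j := by positivity
    have hδk : (1 / 2 : ℝ) ^ j ≤ (1 / 2 : ℝ) ^ (k + 1) :=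
      pow_le_pow_of_le_one (by norm_num) (by norm_num) hkj
    have hx : ∀ x, ∫⁻ θ, g k j (θ, x) ∂σ ≤ 4 ^ m * ∑' l, ea m s C (l + k) := by
      intro x
      let Dx : Set ((Fin m → ℝ) × ((Fin m → ℝ) × ℝ)) := {p | ((p.1, x), p.2) ∈ D k j}
      have hDx : MeasurableSet Dx :=
        (by fun_prop : Measurable fun p : (Fin m → ℝ) × ((Fin m → ℝ) × ℝ) =>
          ((p.1, x), p.2)) (hD k j)
      simp only [g, div_eq_mul_inv]
      have hm1 : Measurable fun θ : Fin m → ℝ => μ (Prod.mk (θ, x) ⁻¹' D k j) :=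
        (measurable_measure_prodMk_left hDx : Measurable fun θ => μ (Prod.mk θ ⁻¹' Dx))
      rw [lintegral_mul_const _ hm1]
      have e1 : ∫⁻ θ, μ (Prod.mk (θ, x) ⁻¹' D k j) ∂σ =
          ∫⁻ y, σ ((fun θ => (θ, y)) ⁻¹' Dx) ∂μ := by
        rw [← Measure.prod_apply_symm hDx, Measure.prod_apply hDx]
        rfl
      rw [e1]
      have hne : ∀ᵐ y ∂μ, y ≠ x := by rw [ae_iff]; simpa using hatom x
      have e2 : ∫⁻ y, σ ((fun θ => (θ, y)) ⁻¹' Dx) ∂μ ≤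
          ENNReal.ofReal (4 * (1 / 2 : ℝ) ^ j) ^ m * ∑' l, ea m s C (l + k) := by
        calc ∫⁻ y, σ ((fun θ => (θ, y)) ⁻¹' Dx) ∂μ
            ≤ ∫⁻ y, (Metric.closedBall x ((1 / 2 : ℝ) ^ k)).indicator (fun y =>
              ENNReal.ofReal (4 * (1 / 2 : ℝ) ^ j) ^ m *
                (ENNReal.ofReal (dist x y))⁻¹ ^ m) y ∂μ := by
              refine lintegral_mono_ae ?_
              filter_upwards [hne] with y hy
              have hσle : σ ((fun θ => (θ, y)) ⁻¹' Dx) ≤ volume {θ : Fin m → ℝ | ‖θ‖ ≤ ε ∧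
                  (θ, y) ∈ Dx} := by
                rw [Measure.restrict_apply
                  ((by fun_prop : Measurable fun θ : Fin m → ℝ => (θ, y)) hDx)]
                exact measure_mono fun θ hθ => ⟨mem_closedBall_zero_iff.1 hθ.2, hθ.1⟩
              refine hσle.trans ?_
              by_cases hyk : y ∈ Metric.closedBall x ((1 / 2 : ℝ) ^ k)
              · rw [indicator_of_mem hyk, dist_eq_norm]
                refine le_trans (measure_mono fun θ hθ => ?_)
                  (dirs (x - y).1 (x - y).2 (sub_ne_zero.2 hy.symm) hδ)
                exact ⟨hθ.1.trans hε1, hθ.2.1⟩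
              · rw [indicator_of_notMem hyk]
                have : {θ : Fin m → ℝ | ‖θ‖ ≤ ε ∧ (θ, y) ∈ Dx} = ∅ := by
                  refine eq_empty_of_forall_notMem fun θ hθ => hyk ?_
                  have h1 : ‖(x.1 - y.1) - (x.2 - y.2) • θ‖ ≤ (1 / 2 : ℝ) ^ j := hθ.2.1
                  have h2 : |x.2 - y.2| ≤ (1 / 2 : ℝ) ^ (k + 1) := hθ.2.2
                  have h3 : ‖(x.2 - y.2) • θ‖ ≤ |x.2 - y.2| := by
                    rw [norm_smul, Real.norm_eq_abs]
                    exact mul_le_of_le_one_right (abs_nonneg _) (hθ.1.trans hε1)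
                  have h4 : ‖x.1 - y.1‖ ≤ ‖(x.1 - y.1) - (x.2 - y.2) • θ‖ +
                      ‖(x.2 - y.2) • θ‖ := by
                    simpa using norm_add_le ((x.1 - y.1) - (x.2 - y.2) • θ) ((x.2 - y.2) • θ)
                  have h5 : (1 / 2 : ℝ) ^ k = 2 * (1 / 2 : ℝ) ^ (k + 1) := by
                    rw [pow_succ]; ring
                  have h6 : (0:ℝ) < (1 / 2 : ℝ) ^ (k + 1) := by positivity
                  rw [Metric.mem_closedBall, dist_comm, Prod.dist_eq, h5]
                  refine max_le ?_ ?_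
                  · rw [dist_eq_norm]; linarith
                  · rw [Real.dist_eq]; linarith
                rw [this]; simp
          _ = ENNReal.ofReal (4 * (1 / 2 : ℝ) ^ j) ^ m *
              ∫⁻ y in Metric.closedBall x ((1 / 2 : ℝ) ^ k),
                (ENNReal.ofReal (dist x y))⁻¹ ^ m ∂μ := by
              rw [lintegral_indicator measurableSet_closedBall, lintegral_const_mul]
              fun_prop
          _ ≤ _ := by
              gcongr
              exact energy x (hatom x) (hμ x) k
      calc _ ≤ (ENNReal.ofReal (4 * (1 / 2 : ℝ) ^ j) ^ m * ∑' l, ea m s C (l + k)) *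
            (ENNReal.ofReal ((1 / 2 : ℝ) ^ j) ^ m)⁻¹ := by
              gcongr
              norm_num
        _ = 4 ^ m * (∑' l, ea m s C (l + k)) * (ENNReal.ofReal ((1 / 2 : ℝ) ^ j) ^ m *
            (ENNReal.ofReal ((1 / 2 : ℝ) ^ j) ^ m)⁻¹) := by
            rw [ENNReal.ofReal_mul (by norm_num), mul_pow]
            norm_num
            ring
        _ = _ := by
            rw [ENNReal.mul_inv_cancel (by positivity) (by finiteness), mul_one]
    calc _ ≤ ∫⁻ _, 4 ^ m * ∑' l, ea m s C (l + k) ∂μ := lintegral_mono hx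
      _ = _ := by simp
  have hG : ∀ k, ∫⁻ p, liminf (fun j => g k j p) atTop ∂(σ.prod μ) ≤
      4 ^ m * ∑' l, ea m s C (l + k) := by
    intro k
    refine (lintegral_liminf_le (hg k)).trans ?_
    refine liminf_le_of_frequently_le' (Eventually.frequently ?_)
    filter_upwards [eventually_ge_atTop (k + 1)] with j hj using hbound k j hj
  have hzero : ∫⁻ p, ⨅ k, liminf (fun j => g k j p) atTop ∂(σ.prod μ) = 0 := by
    have h1 : ∀ k, ∫⁻ p, ⨅ k, liminf (fun j => g k j p) atTop ∂(σ.prod μ) ≤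
        4 ^ m * ∑' l, ea m s C (l + k) := fun k =>
      (lintegral_mono fun p => iInf_le _ k).trans (hG k)
    have h2 := ENNReal.Tendsto.const_mul (a := (4 : ℝ≥0∞) ^ m)
      (ENNReal.tendsto_sum_nat_add (ea m s C) (ea_sum hs hC)) (Or.inr (by finiteness))
    rw [mul_zero] at h2
    exact le_antisymm (ge_of_tendsto' h2 h1) zero_le
  rw [lintegral_eq_zero_iff (Measurable.iInf fun k => Measurable.liminf (hg k))] at hzero
  have hae := Measure.ae_ae_of_ae_prod hzero
  have hσ0 : σ ≠ 0 := by
    intro h0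
    have : σ univ = 0 := by rw [h0]; simp
    simp only [σ, Measure.restrict_apply_univ] at this
    exact (Metric.measure_closedBall_pos volume (0 : Fin m → ℝ) hε).ne' this
  have hσmem : ∀ᵐ θ ∂σ, θ ∈ Metric.closedBall (0 : Fin m → ℝ) ε :=
    ae_restrict_mem measurableSet_closedBall
  have : NeZero σ := ⟨hσ0⟩
  obtain ⟨θ, hθ, hθε⟩ := (hae.and hσmem).exists
  have hθε' : ‖θ‖ ≤ ε := mem_closedBall_zero_iff.1 hθε
  let Φ : (Fin m → ℝ) × ℝ → (Fin m → ℝ) × ℝ := fun x => (x.1 - x.2 • θ, x.2)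
  let Ψ : (Fin m → ℝ) × ℝ → (Fin m → ℝ) × ℝ := fun x => (x.1 + x.2 • θ, x.2)
  have hΦ : Measurable Φ := by fun_prop
  have hΨ : Measurable Ψ := by fun_prop
  have hΨΦ : ∀ x, Ψ (Φ x) = x := fun x => by simp [Ψ, Φ]
  have hΦΨ : ∀ x, Φ (Ψ x) = x := fun x => by simp [Ψ, Φ]
  let e : (Fin m → ℝ) × ℝ ≃ᵐ (Fin m → ℝ) × ℝ := ⟨⟨Φ, Ψ, hΨΦ, hΦΨ⟩, hΦ, hΨ⟩
  have hprob : IsProbabilityMeasure (μ.map Φ) := Measure.isProbabilityMeasure_map hΦ.aemeasurable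
  have hmapae : ∀ P : (Fin m → ℝ) × ℝ → Prop, (∀ᵐ x ∂μ, P (Φ x)) → ∀ᵐ p ∂(μ.map Φ), P p := by
    intro P hP
    have : Φ = e := rfl
    rw [this, e.measurableEmbedding.ae_map_iff]
    exact hP
  refine disint (μ.map Φ) (F := Ψ ⁻¹' E) ?_ ?_ ?_
  · refine hmapae _ ?_
    have : ∀ᵐ x ∂μ, x ∈ E := hE0
    filter_upwards [this] with x hx
    rw [mem_preimage, hΨΦ]; exact hx
  · intro y
    refine (hlines θ hθε' (y, 0)).mono fun t ht => ?_
    have : (y, (0:ℝ)) + t • (θ, (1:ℝ)) = Ψ (y, t) := by simp [Ψ]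
    change _ ∈ E
    rw [this]; exact ht
  · refine hmapae _ ?_
    filter_upwards [hθ] with x hx
    rw [← show (⨅ k, liminf (fun j => g k j (θ, x)) atTop) = 0 from hx]
    congr 1; funext k
    congr 1; funext j
    simp only [g]
    rw [Measure.map_apply hΦ (measurableSet_closedBall.prod measurableSet_closedBall)]
    congr 2
    ext y
    simp only [mem_preimage, mem_prod, Metric.mem_closedBall, D, Φ]
    rw [dist_comm, dist_eq_norm, dist_comm y.2, Real.dist_eq]
    have : x.1 - x.2 • θ - (y.1 - y.2 • θ) = x.1 - y.1 - (x.2 - y.2) • θ := by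
      rw [sub_smul]; abel
    rw [this]
    rfl

end FrostAux

namespace FrostAux

open scoped ENNReal NNReal Topology
open MeasureTheory Set Filter

theorem final (m : ℕ) (C : Set (EuclideanSpace ℝ (Fin (m+1))))
    (hCopen : IsOpen C) (hCne : C.Nonempty) (hC0 : (0 : EuclideanSpace ℝ (Fin (m+1))) ∉ C)
    (Et : Set (EuclideanSpace ℝ (Fin (m+1)))) (hBorel : MeasurableSet Et)
    (hlines : ∀ x : EuclideanSpace ℝ (Fin (m+1)), ∀ v ∈ C,
      {t : ℝ | x + t • v ∈ Et}.Countable) :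
    dimH Et ≤ (m : ℝ≥0∞) := by
  obtain ⟨v0, hv0⟩ := hCne
  have hv00 : v0 ≠ 0 := fun h => hC0 (h ▸ hv0)
  let e₁ : EuclideanSpace ℝ (Fin (m+1)) ≃L[ℝ] (Fin (m+1) → ℝ) :=
    EuclideanSpace.equiv (Fin (m+1)) ℝ
  have hfr : Module.finrank ℝ (EuclideanSpace ℝ (Fin (m+1))) =
      Module.finrank ℝ ((Fin m → ℝ) × ℝ) := by simp
  let L0 : EuclideanSpace ℝ (Fin (m+1)) ≃L[ℝ] (Fin m → ℝ) × ℝ :=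
    ContinuousLinearEquiv.ofFinrankEq hfr
  obtain ⟨L1, hL1⟩ := SeparatingDual.exists_continuousLinearEquiv_apply_eq (R := ℝ)
    (V := (Fin m → ℝ) × ℝ) (x := L0 v0) (y := ((0 : Fin m → ℝ), (1:ℝ)))
    (by simpa using hv00) (by simp)
  let L : EuclideanSpace ℝ (Fin (m+1)) ≃L[ℝ] (Fin m → ℝ) × ℝ := L0.trans L1
  have hL : L.symm (0, 1) = v0 := by
    rw [ContinuousLinearEquiv.symm_apply_eq]; exact hL1.symm
  rw [← e₁.dimH_image]
  refine dimH_le fun d hd => ?_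
  by_contra hlt
  have hlt' : (m : ℝ) < (d : ℝ) := by
    have h1 : (m : ℝ≥0∞) < (d : ℝ≥0∞) := not_le.mp hlt
    have h2 : (m : ℝ≥0) < d := by exact_mod_cast h1
    exact_mod_cast h2
  have hd0 : (0:ℝ) < d := lt_of_le_of_lt (Nat.cast_nonneg m) hlt'
  have hE1 : MeasurableSet (e₁ '' Et) :=
    (e₁.toHomeomorph.measurableEmbedding.measurableSet_image).2 hBorel
  obtain ⟨μ, hμp, hμE, K, hK, hμK⟩ := frostman hE1 hd0 (by rw [hd]; simp)
  let A : (Fin (m+1) → ℝ) ≃L[ℝ] (Fin m → ℝ) × ℝ := e₁.symm.trans L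
  have hAm : Measurable A := A.continuous.measurable
  have hpm : IsProbabilityMeasure (μ.map A) := Measure.isProbabilityMeasure_map hAm.aemeasurable
  let M : ℝ := ‖(A.symm : ((Fin m → ℝ) × ℝ) →L[ℝ] (Fin (m+1) → ℝ))‖ + 1
  have hM : 0 < M := by positivity
  let EX : Set ((Fin m → ℝ) × ℝ) := L.symm ⁻¹' Et
  have hEX : MeasurableSet EX := L.symm.continuous.measurable hBorel
  have hopen : IsOpen {θ : Fin m → ℝ | L.symm (θ, 1) ∈ C} :=
    hCopen.preimage (by fun_prop)
  obtain ⟨δ, hδ, hδC⟩ := Metric.isOpen_iff.1 hopen 0 (by simpa [hL] using hv0)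
  refine slice (μ.map A) hlt' (C := K * ENNReal.ofReal (M ^ (d:ℝ)))
    (ENNReal.mul_ne_top hK ENNReal.ofReal_ne_top) ?_ (E := EX) hEX ?_
    (ε := min (δ / 2) 1) (by positivity) (min_le_right _ _) ?_
  · intro x r hr
    rw [Measure.map_apply hAm measurableSet_closedBall]
    calc μ (A ⁻¹' Metric.closedBall x r) ≤ μ (Metric.closedBall (A.symm x) (M * r)) := by
          refine measure_mono fun y hy => ?_
          rw [mem_preimage, mem_closedBall_iff_norm] at hy
          rw [mem_closedBall_iff_norm]
          have h1 : y - A.symm x = A.symm (A y - x) := by simp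
          rw [h1]
          calc ‖A.symm (A y - x)‖ ≤ ‖(A.symm : ((Fin m → ℝ) × ℝ) →L[ℝ] (Fin (m+1) → ℝ))‖ *
                ‖A y - x‖ := ContinuousLinearMap.le_opNorm
                  (A.symm : ((Fin m → ℝ) × ℝ) →L[ℝ] (Fin (m+1) → ℝ)) _
            _ ≤ M * r := by
              gcongr
              simp [M]
      _ ≤ K * ENNReal.ofReal ((M * r) ^ (d:ℝ)) := hμK _ _ (by positivity)
      _ = _ := by
        rw [Real.mul_rpow hM.le hr.le, ENNReal.ofReal_mul (by positivity), mul_assoc]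
  · rw [Measure.map_apply hAm hEX.compl]
    refine measure_mono_null (fun y hy => ?_) hμE
    rintro ⟨z, hz, rfl⟩
    apply hy
    simpa [EX, A] using hz
  · intro θ hθ x
    have hmem : L.symm (θ, 1) ∈ C := by
      apply hδC
      rw [mem_ball_zero_iff]
      have := min_le_left (δ / 2) 1
      linarith
    refine (hlines (L.symm x) _ hmem).mono fun t ht => ?_
    have h2 : L.symm (x + t • (θ, (1:ℝ))) ∈ Et := ht
    rw [map_add, map_smul] at h2
    exact h2

end FrostAux

/-- If `Ẽ ⊆ ℝⁿ` is a Borel set meeting every line with direction in a nonempty open cone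
`C` in an at most countable set, then `dimH Ẽ ≤ n - 1`. -/
theorem stmt18 (n : ℕ) (C : Set (EuclideanSpace ℝ (Fin n)))
    (hCopen : IsOpen C) (hCne : C.Nonempty) (hC0 : (0 : EuclideanSpace ℝ (Fin n)) ∉ C)
    (hCcone : ∀ v ∈ C, ∀ t : ℝ, 0 < t → t • v ∈ C)
    (Et : Set (EuclideanSpace ℝ (Fin n))) (hBorel : MeasurableSet Et)
    (hlines : ∀ x : EuclideanSpace ℝ (Fin n), ∀ v ∈ C,
      {t : ℝ | x + t • v ∈ Et}.Countable) :
    dimH Et ≤ (n : ℝ≥0∞) - 1 := by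
  cases n with
  | zero =>
    obtain ⟨v, hv⟩ := hCne
    exact absurd (Subsingleton.elim v 0 ▸ hv) hC0
  | succ m =>
    have h := FrostAux.final m C hCopen hCne hC0 Et hBorel hlines
    have h2 : ((m + 1 : ℕ) : ℝ≥0∞) - 1 = m := by
      push_cast
      exact ENNReal.add_sub_cancel_right ENNReal.one_ne_top
    rw [h2]
    exact h
end
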